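/- arXiv:1805.04640 — 7 statements merged into one kernel-verified Lean document; each statement's English description precedes it below -/
import Mathlib

section
/- Let F be a field. Consider pairs (v,g) with v a nonzero row vector in F^2 and g ∈ SL_2(F), and the right action of h ∈ SL_2(F) given by (v,g)·h = (v·h, h^{-1}·g·h). Define ω(v,w) = v_0 w_1 - v_1 w_0, c(v,g) = -ω(v, v·g) and t(v,g) = trace(g). If (v_1,g_1) and (v_2,g_2) satisfy c(v_1,g_1) = c(v_2,g_2) ≠ 0 and trace(g_1) = trace(g_2), then there exists a unique h ∈ SL_2(F) with v_1·h = v_2 and h^{-1}·g_1·h = g_2. (That is, the diagonal SL_2-action on the open locus c ≠ 0 of the Rankin–Selberg variety is simply transitive on each fiber of the invariant map (c,t).) -/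
open Matrix

/-- The standard symplectic form on `F²`: `ω(v,w) = v₀w₁ - v₁w₀`. -/
def sympForm {F : Type*} [Field F] (v w : Fin 2 → F) : F := v 0 * w 1 - v 1 * w 0

/-- The matrix with rows `v` and `v·g`. -/
def cyclicMatrix {F : Type*} [Field F] (v : Fin 2 → F) (g : Matrix (Fin 2) (Fin 2) F) :
    Matrix (Fin 2) (Fin 2) F := Matrix.of ![v, vecMul v g]

section cyclicMatrix

variable {F : Type*} [Field F]

theorem det_cyclicMatrix (v : Fin 2 → F) (g : Matrix (Fin 2) (Fin 2) F) :
    (cyclicMatrix v g).det = sympForm v (vecMul v g) := by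
  simp [cyclicMatrix, det_fin_two, sympForm]

/-- Cayley–Hamilton: in the basis `v, v·g`, the matrix `g` becomes a companion matrix. -/
theorem cyclicMatrix_mul_self (v : Fin 2 → F) (g : Matrix (Fin 2) (Fin 2) F) :
    cyclicMatrix v g * g = !![0, 1; -g.det, g.trace] * cyclicMatrix v g := by
  ext i j
  fin_cases i <;> fin_cases j <;>
    simp [cyclicMatrix, Matrix.mul_apply, vecMul, dotProduct, Fin.sum_univ_two, det_fin_two,
      trace_fin_two] <;> ring

theorem cyclicMatrix_mul_eq_iff (v w : Fin 2 → F) (g g' h : Matrix (Fin 2) (Fin 2) F) :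
    cyclicMatrix v g * h = cyclicMatrix w g' ↔
      vecMul v h = w ∧ vecMul v (g * h) = vecMul w g' := by
  rw [← Matrix.ext_iff]
  simp only [Fin.forall_fin_two, funext_iff, ← vecMul_vecMul]
  rfl

/-- An element of `SL₂` carries `(v, g)` to `(w, g')` exactly when it carries the basis
`v, v·g` to `w, w·g'`. -/
theorem vecMul_eq_and_conj_eq_iff {v w : Fin 2 → F} {g g' : SpecialLinearGroup (Fin 2) F}
    (hv : sympForm v (vecMul v (g : Matrix (Fin 2) (Fin 2) F)) ≠ 0)
    (ht : (g : Matrix (Fin 2) (Fin 2) F).trace = (g' : Matrix (Fin 2) (Fin 2) F).trace)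
    (h : SpecialLinearGroup (Fin 2) F) :
    (vecMul v (h : Matrix (Fin 2) (Fin 2) F) = w ∧ h⁻¹ * g * h = g') ↔
      cyclicMatrix v (g : Matrix (Fin 2) (Fin 2) F) * (h : Matrix (Fin 2) (Fin 2) F) =
        cyclicMatrix w (g' : Matrix (Fin 2) (Fin 2) F) := by
  rw [mul_assoc, inv_mul_eq_iff_eq_mul]
  constructor
  · rintro ⟨hw, hg⟩
    refine (cyclicMatrix_mul_eq_iff ..).2 ⟨hw, ?_⟩
    have hg' : (g : Matrix (Fin 2) (Fin 2) F) * (h : Matrix (Fin 2) (Fin 2) F) = h * g' :=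
      congrArg Subtype.val hg
    rw [hg', ← vecMul_vecMul, hw]
  · intro hB
    refine ⟨((cyclicMatrix_mul_eq_iff ..).1 hB).1, Subtype.ext ?_⟩
    have hu : IsUnit (cyclicMatrix v (g : Matrix (Fin 2) (Fin 2) F)) := by
      rwa [isUnit_iff_isUnit_det, det_cyclicMatrix, isUnit_iff_ne_zero]
    apply hu.mul_left_cancel
    change _ * ((g : Matrix (Fin 2) (Fin 2) F) * (h : Matrix (Fin 2) (Fin 2) F)) = _ * ((h : Matrix (Fin 2) (Fin 2) F) * (g' : Matrix (Fin 2) (Fin 2) F))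
    rw [← mul_assoc, ← mul_assoc, hB,
      cyclicMatrix_mul_self, cyclicMatrix_mul_self, mul_assoc, hB, ht, g.det_coe, g'.det_coe]

end cyclicMatrix

/-- On the locus `c ≠ 0` of the Rankin–Selberg variety, the diagonal `SL₂`-action is simply
transitive on each fiber of the invariant map `(c,t) = (-ω(v, v·g), tr g)`. -/
theorem stmt_0 {F : Type*} [Field F]
    (v₁ v₂ : Fin 2 → F) (g₁ g₂ : SpecialLinearGroup (Fin 2) F)
    (hv₁ : v₁ ≠ 0) (hv₂ : v₂ ≠ 0)
    (hc : -sympForm v₁ (vecMul v₁ (g₁ : Matrix (Fin 2) (Fin 2) F)) =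
          -sympForm v₂ (vecMul v₂ (g₂ : Matrix (Fin 2) (Fin 2) F)))
    (hc0 : -sympForm v₁ (vecMul v₁ (g₁ : Matrix (Fin 2) (Fin 2) F)) ≠ 0)
    (ht : Matrix.trace (g₁ : Matrix (Fin 2) (Fin 2) F) =
          Matrix.trace (g₂ : Matrix (Fin 2) (Fin 2) F)) :
    ∃! h : SpecialLinearGroup (Fin 2) F,
      vecMul v₁ (h : Matrix (Fin 2) (Fin 2) F) = v₂ ∧ h⁻¹ * g₁ * h = g₂ := by
  rw [ne_eq, neg_eq_zero] at hc0
  rw [neg_inj] at hc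
  simp only [vecMul_eq_and_conj_eq_iff hc0 ht]
  rw [← det_cyclicMatrix] at hc0 hc
  rw [← det_cyclicMatrix] at hc
  have hu := isUnit_iff_ne_zero.2 hc0
  refine ⟨⟨(cyclicMatrix v₁ g₁)⁻¹ * cyclicMatrix v₂ g₂, ?_⟩,
    mul_nonsing_inv_cancel_left _ _ hu, fun h hh => Subtype.ext ?_⟩
  · rw [det_mul, det_nonsing_inv, ← hc, Ring.inverse_mul_cancel _ hu]
  · exact (nonsing_inv_mul_cancel_left _ _ hu).symm.trans (congrArg _ hh)
end

section
/- Let F be a field in which 2 is invertible, and let g ∈ SL_2(F). Define the quadratic form Q_g on F^2 (column vectors) by Q_g(v) = ω(v, g·v), where ω(v,w) = v_0 w_1 - v_1 w_0 and g·v is matrix-vector multiplication. Then for every h ∈ SL_2(F): h commutes with g (h·g = g·h as matrices) if and only if Q_g(h·v) = Q_g(v) for every v ∈ F^2. In particular, for g with trace(g)^2 ≠ 4 the centralizer of g in SL_2(F) equals the group of elements of SL_2(F) preserving the nondegenerate quadratic form Q_g. -/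
open Matrix

theorem sympForm_mulVec_mulVec {F : Type*} [Field F] (A : Matrix (Fin 2) (Fin 2) F)
    (v w : Fin 2 → F) : sympForm (A *ᵥ v) (A *ᵥ w) = A.det * sympForm v w := by
  simp only [sympForm, mulVec_eq_sum, Fin.sum_univ_two, det_fin_two, Pi.add_apply, Pi.smul_apply,
    transpose_apply, op_smul_eq_smul, smul_eq_mul]
  ring

theorem sympForm_sub_right {F : Type*} [Field F] (v w w' : Fin 2 → F) :
    sympForm v (w - w') = sympForm v w - sympForm v w' := by
  simp only [sympForm, Pi.sub_apply]
  ring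

/-- A traceless `2 × 2` matrix is determined by the quadratic form `v ↦ ω(v, A v)`. -/
theorem eq_zero_of_sympForm_mulVec_self_eq_zero {F : Type*} [Field F] (h2 : (2 : F) ≠ 0)
    {A : Matrix (Fin 2) (Fin 2) F} (htr : A.trace = 0)
    (hA : ∀ v, sympForm v (A *ᵥ v) = 0) : A = 0 := by
  have h10 : A 1 0 = 0 := by simpa [sympForm, mulVec_eq_sum] using hA ![1, 0]
  have h01 : A 0 1 = 0 := by simpa [sympForm, mulVec_eq_sum] using hA ![0, 1]
  have hdiag : A 1 1 - A 0 0 = 0 := by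
    simpa [sympForm, mulVec_eq_sum, h10, h01] using hA ![1, 1]
  rw [trace_fin_two] at htr
  have h00 : A 0 0 = 0 := (mul_eq_zero_iff_left h2).mp (by linear_combination htr - hdiag)
  have h11 : A 1 1 = 0 := by linear_combination htr - h00
  ext i j
  fin_cases i <;> fin_cases j <;> assumption

/-- For `g ∈ SL₂(F)` (with `2` invertible in `F`), an element `h ∈ SL₂(F)` commutes with `g`
if and only if it preserves the quadratic form `Q_g(v) = ω(v, g·v)`. -/
theorem stmt_2 {F : Type*} [Field F] [Invertible (2 : F)]
    (g h : SpecialLinearGroup (Fin 2) F) :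
    (h : Matrix (Fin 2) (Fin 2) F) * (g : Matrix (Fin 2) (Fin 2) F) =
      (g : Matrix (Fin 2) (Fin 2) F) * (h : Matrix (Fin 2) (Fin 2) F) ↔
    ∀ v : Fin 2 → F,
      sympForm (mulVec (h : Matrix (Fin 2) (Fin 2) F) v)
          (mulVec (g : Matrix (Fin 2) (Fin 2) F) (mulVec (h : Matrix (Fin 2) (Fin 2) F) v)) =
        sympForm v (mulVec (g : Matrix (Fin 2) (Fin 2) F) v) := by
  have hdet := h.det_coe
  have hu : IsUnit (h : Matrix (Fin 2) (Fin 2) F).det := by simp [hdet]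
  generalize (h : Matrix (Fin 2) (Fin 2) F) = H at hdet hu ⊢
  generalize (g : Matrix (Fin 2) (Fin 2) F) = G
  constructor
  · intro hcomm v
    rw [mulVec_mulVec, ← hcomm, ← mulVec_mulVec, sympForm_mulVec_mulVec, hdet, one_mul]
  · intro hQ
    have hconj : H⁻¹ * G * H - G = 0 := by
      refine eq_zero_of_sympForm_mulVec_self_eq_zero (Invertible.ne_zero 2) ?_ fun v => ?_
      · rw [trace_sub, trace_mul_comm, mul_nonsing_inv_cancel_left _ _ hu, sub_self]
      · rw [sub_mulVec, sympForm_sub_right, ← hQ v, sub_eq_zero,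
          ← one_mul (sympForm v _), ← hdet, ← sympForm_mulVec_mulVec, mulVec_mulVec,
          mulVec_mulVec, Matrix.mul_assoc H⁻¹, mul_nonsing_inv_cancel_left _ _ hu]
    rw [sub_eq_zero, Matrix.mul_assoc] at hconj
    simpa only [mul_nonsing_inv_cancel_left _ _ hu] using congrArg (H * ·) hconj.symm
end

section
/- Let Φ_1, Φ_2 : ℝ² → ℂ be Schwartz functions. For ξ ≠ 0 and a Schwartz function Φ define the split orbital integral O_ξ(Φ) = ∫_ℝ Φ(u, ξ/u) |u|^{-1} du (an absolutely convergent integral), and define the symplectic Fourier transform 𝔉Φ(u,v) = ∫_{ℝ²} Φ(x,y) exp(-2πi(x v − y u)) dx dy. If O_ξ(Φ_1) = O_ξ(Φ_2) for every ξ ≠ 0, then O_ξ(𝔉Φ_1) = O_ξ(𝔉Φ_2) for every ξ ≠ 0. -/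
open MeasureTheory

/-- The split orbital integral `O_ξ(Φ) = ∫ Φ(u, ξ/u) |u|⁻¹ du` over the orbit `{xy = ξ}` of the
split torus. -/
noncomputable def orbInt (Φ : ℝ × ℝ → ℂ) (ξ : ℝ) : ℂ :=
  ∫ u : ℝ, Φ (u, ξ / u) * ((|u| : ℝ) : ℂ)⁻¹

/-- The symplectic Fourier transform `𝔉Φ(u,v) = ∫ Φ(x,y) exp(-2πi(xv − yu)) dx dy`. -/
noncomputable def symplFT (Φ : ℝ × ℝ → ℂ) : ℝ × ℝ → ℂ := fun p =>
  ∫ q : ℝ × ℝ, Φ q * Complex.exp (-(2 * Real.pi * Complex.I) *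
    ((q.1 * p.2 - q.2 * p.1 : ℝ) : ℂ))

open FourierTransform

/-- The additive character `t ↦ exp(-2πit)` of `ℝ`. -/
noncomputable def expChar (t : ℝ) : ℂ := Complex.exp (-(2 * Real.pi * Complex.I) * (t : ℂ))

lemma continuous_expChar : Continuous expChar := by
  unfold expChar; fun_prop

lemma norm_expChar (t : ℝ) : ‖expChar t‖ = 1 := by
  rw [expChar, show -(2 * Real.pi * Complex.I) * (t : ℂ) = ((-(2 * Real.pi * t) : ℝ) : ℂ) * Complex.I
    by push_cast; ring]
  exact Complex.norm_exp_ofReal_mul_I _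

lemma expChar_add (s t : ℝ) : expChar (s + t) = expChar s * expChar t := by
  rw [expChar, expChar, expChar, ← Complex.exp_add]
  push_cast
  ring_nf

lemma fourier_eq_integral_expChar (f : ℝ → ℂ) (w : ℝ) :
    𝓕 f w = ∫ v : ℝ, f v * expChar (v * w) := by
  rw [Real.fourier_real_eq_integral_exp_smul]
  refine integral_congr_ae (.of_forall fun v => ?_)
  simp only [smul_eq_mul, expChar]
  rw [mul_comm]
  push_cast
  ring_nf

lemma symplFT_apply (Φ : ℝ × ℝ → ℂ) (p : ℝ × ℝ) :
    symplFT Φ p = ∫ q : ℝ × ℝ, Φ q * expChar (q.1 * p.2 - q.2 * p.1) := rfl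

lemma MeasureTheory.Integrable.mul_expChar {α : Type*} [MeasurableSpace α] {μ : Measure α}
    {f : α → ℂ} (hf : Integrable f μ) {g : α → ℝ} (hg : Measurable g) :
    Integrable (fun x => f x * expChar (g x)) μ :=
  hf.mul_bdd (c := 1) (continuous_expChar.measurable.comp hg).aestronglyMeasurable
    (.of_forall fun _ => (norm_expChar _).le)

/-- The symplectic Fourier transform preserves Schwartz functions. -/
lemma exists_schwartzMap_eq_symplFT (Φ : SchwartzMap (ℝ × ℝ) ℂ) :
    ∃ G : SchwartzMap (ℝ × ℝ) ℂ, ⇑G = symplFT Φ := by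
  let e : (ℝ × ℝ) ≃L[ℝ] ℂ := ((ContinuousLinearEquiv.prodComm ℝ ℝ ℝ).trans
    ((ContinuousLinearEquiv.refl ℝ ℝ).prodCongr (ContinuousLinearEquiv.neg ℝ))).trans
    Complex.equivRealProdCLM.symm
  refine ⟨SchwartzMap.compCLMOfContinuousLinearEquiv ℂ e
    (𝓕 (SchwartzMap.compCLMOfContinuousLinearEquiv ℂ Complex.equivRealProdCLM Φ)), ?_⟩
  ext p
  rw [SchwartzMap.compCLMOfContinuousLinearEquiv_apply, Function.comp_apply,
    SchwartzMap.fourier_coe, Real.fourier_eq', symplFT_apply,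
    ← Complex.volume_preserving_equiv_real_prod.integral_comp
      Complex.measurableEquivRealProd.measurableEmbedding]
  refine integral_congr_ae (.of_forall fun z => ?_)
  have he : e p = ⟨p.2, -p.1⟩ := rfl
  simp only [smul_eq_mul, expChar, SchwartzMap.compCLMOfContinuousLinearEquiv_apply,
    Function.comp_apply, Complex.equivRealProdCLM_apply, Complex.measurableEquivRealProd_apply,
    Complex.inner, he]
  rw [mul_comm]
  congr 2
  simp
  ring

lemma SchwartzMap.exists_bound_snd (Φ : SchwartzMap (ℝ × ℝ) ℂ) :
    ∃ C, ∀ x y, ‖Φ (x, y)‖ ≤ C * (1 + y ^ 2)⁻¹ := by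
  obtain ⟨A, -, hA⟩ := Φ.decay 0 0
  obtain ⟨B, -, hB⟩ := Φ.decay 2 0
  refine ⟨A + B, fun x y => ?_⟩
  have h1 := hA (x, y)
  have h2 := hB (x, y)
  simp only [norm_iteratedFDeriv_zero, pow_zero, one_mul] at h1 h2
  have h3 : y ^ 2 ≤ ‖(x, y)‖ ^ 2 := by
    rw [← sq_abs y]
    gcongr
    exact norm_snd_le (x, y)
  rw [← div_eq_mul_inv, le_div_iff₀ (by positivity)]
  nlinarith [norm_nonneg (Φ (x, y))]

/-- The integrand of a split orbital integral is dominated, locally uniformly in `ξ ≠ 0`. -/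
lemma SchwartzMap.exists_bound_orbit (Φ : SchwartzMap (ℝ × ℝ) ℂ) :
    ∃ C, 0 ≤ C ∧ ∀ ξ u : ℝ, ξ ≠ 0 →
      ‖Φ (u, ξ / u) * ((|u| : ℝ) : ℂ)⁻¹‖ ≤ C / |ξ| * (1 + u ^ 2)⁻¹ := by
  obtain ⟨A, hA0, hA⟩ := Φ.decay 1 0
  obtain ⟨B, hB0, hB⟩ := Φ.decay 3 0
  refine ⟨A + B, by positivity, fun ξ u hξ => ?_⟩
  rcases eq_or_ne u 0 with rfl | hu
  · simp
    positivity
  have h1 := hA (u, ξ / u)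
  have h2 := hB (u, ξ / u)
  simp only [norm_iteratedFDeriv_zero, pow_one] at h1 h2
  have h3 : |ξ| / |u| ≤ ‖(u, ξ / u)‖ := by
    rw [← abs_div]; exact norm_snd_le (u, ξ / u)
  have h4 : |u| ≤ ‖(u, ξ / u)‖ := norm_fst_le (u, ξ / u)
  have hu' : 0 < |u| := abs_pos.2 hu
  have hξ' : 0 < |ξ| := abs_pos.2 hξ
  set N := ‖(u, ξ / u)‖
  set w := ‖Φ (u, ξ / u)‖ with hw
  have hw0 : 0 ≤ w := norm_nonneg _
  have h5 : |ξ| / |u| * (1 + u ^ 2) ≤ N + N ^ 3 := by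
    rw [← sq_abs u]
    calc |ξ| / |u| * (1 + |u| ^ 2) ≤ N * (1 + N ^ 2) := by gcongr
      _ = N + N ^ 3 := by ring
  have h6 : w * (|ξ| / |u| * (1 + u ^ 2)) ≤ A + B := by
    nlinarith [mul_le_mul_of_nonneg_left h5 hw0]
  rw [norm_mul, norm_inv, Complex.norm_real, Real.norm_eq_abs, abs_abs, ← hw, ← div_eq_mul_inv,
    ← div_eq_mul_inv, div_div, le_div_iff₀ (by positivity)]
  calc w / |u| * (|ξ| * (1 + u ^ 2)) = w * (|ξ| / |u| * (1 + u ^ 2)) := by ring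
    _ ≤ A + B := h6

lemma Real.ae_ne_zero : ∀ᵐ x : ℝ, x ≠ 0 := by simp [ae_iff]

lemma measurable_orbit_integrand (Φ : SchwartzMap (ℝ × ℝ) ℂ) :
    Measurable fun p : ℝ × ℝ => Φ (p.1, p.2 / p.1) * ((|p.1| : ℝ) : ℂ)⁻¹ := by
  have := Φ.continuous.measurable
  have h : Measurable fun p : ℝ × ℝ => |p.1| := continuous_abs.measurable.comp measurable_fst
  fun_prop

lemma integrable_orbit (Φ : SchwartzMap (ℝ × ℝ) ℂ) {ξ : ℝ} (hξ : ξ ≠ 0) :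
    Integrable fun u : ℝ => Φ (u, ξ / u) * ((|u| : ℝ) : ℂ)⁻¹ := by
  obtain ⟨C, -, hC⟩ := Φ.exists_bound_orbit
  refine (integrable_inv_one_add_sq.const_mul (C / |ξ|)).mono'
    ((measurable_orbit_integrand Φ).comp (measurable_id.prodMk measurable_const)).aestronglyMeasurable
    (.of_forall fun u => hC ξ u hξ)

lemma orbInt_sub (Φ₁ Φ₂ : SchwartzMap (ℝ × ℝ) ℂ) {ξ : ℝ} (hξ : ξ ≠ 0) :
    orbInt (Φ₁ - Φ₂ : SchwartzMap (ℝ × ℝ) ℂ) ξ = orbInt Φ₁ ξ - orbInt Φ₂ ξ := by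
  rw [orbInt, orbInt, orbInt, ← integral_sub (integrable_orbit Φ₁ hξ) (integrable_orbit Φ₂ hξ)]
  simp [sub_mul]

lemma symplFT_sub (Φ₁ Φ₂ : SchwartzMap (ℝ × ℝ) ℂ) (p : ℝ × ℝ) :
    symplFT (Φ₁ - Φ₂ : SchwartzMap (ℝ × ℝ) ℂ) p = symplFT Φ₁ p - symplFT Φ₂ p := by
  have hm : Measurable fun q : ℝ × ℝ => q.1 * p.2 - q.2 * p.1 := by fun_prop
  rw [symplFT_apply, symplFT_apply, symplFT_apply,
    ← integral_sub (Φ₁.integrable.mul_expChar hm) (Φ₂.integrable.mul_expChar hm)]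
  simp [sub_mul]

lemma continuousAt_orbInt (Φ : SchwartzMap (ℝ × ℝ) ℂ) {ξ : ℝ} (hξ : ξ ≠ 0) :
    ContinuousAt (orbInt Φ) ξ := by
  obtain ⟨C, hC0, hC⟩ := Φ.exists_bound_orbit
  have hξ' : 0 < |ξ| := abs_pos.2 hξ
  have hev : ∀ᶠ η in nhds ξ, |ξ| / 2 < |η| :=
    continuous_abs.continuousAt.eventually_const_lt (by linarith)
  refine continuousAt_of_dominated (bound := fun u => C / (|ξ| / 2) * (1 + u ^ 2)⁻¹)
    (.of_forall fun η => ((measurable_orbit_integrand Φ).comp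
      (measurable_id.prodMk measurable_const)).aestronglyMeasurable)
    ?_ (integrable_inv_one_add_sq.const_mul _) (.of_forall fun u => ?_)
  · filter_upwards [hev] with η hη
    refine .of_forall fun u => (hC η u (abs_pos.1 (by linarith))).trans ?_
    gcongr
  · have := Φ.continuous
    have : Continuous fun η : ℝ => Φ (u, η / u) * ((|u| : ℝ) : ℂ)⁻¹ := by fun_prop
    exact this.continuousAt

lemma integrable_orbit_integrand (Φ : SchwartzMap (ℝ × ℝ) ℂ) :
    Integrable fun p : ℝ × ℝ => Φ (p.1, p.2 / p.1) * ((|p.1| : ℝ) : ℂ)⁻¹ := by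
  have hΦ : Integrable Φ (volume.prod volume) := Φ.integrable
  have hne : ∀ᵐ x : ℝ, x ≠ 0 := Real.ae_ne_zero
  refine (integrable_prod_iff (measurable_orbit_integrand Φ).aestronglyMeasurable).2 ⟨?_, ?_⟩
  · filter_upwards [hΦ.prod_right_ae, hne] with x hx hx0
    exact (hx.comp_div hx0).mul_const _
  · refine hΦ.norm.integral_prod_left.congr ?_
    filter_upwards [hne] with x hx0
    simp only [norm_mul, norm_inv, Complex.norm_real, Real.norm_eq_abs, abs_abs]
    rw [integral_mul_const, Measure.integral_comp_div (fun y => ‖Φ (x, y)‖), smul_eq_mul]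
    have : |x| ≠ 0 := abs_ne_zero.2 hx0
    field_simp

lemma integrable_orbInt (Φ : SchwartzMap (ℝ × ℝ) ℂ) : Integrable (orbInt Φ) :=
  (integrable_orbit_integrand Φ).integral_prod_right

/-- The Fourier transform of the orbital integrals of `Φ` is the integral of `Φ` against the
Gaussian character of the quadratic form `xy`. -/
lemma fourier_orbInt (Φ : SchwartzMap (ℝ × ℝ) ℂ) (s : ℝ) :
    𝓕 (orbInt Φ) s = ∫ x : ℝ, ∫ y : ℝ, Φ (x, y) * expChar (x * y * s) := by
  have hne : ∀ᵐ x : ℝ, x ≠ 0 := Real.ae_ne_zero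
  have hint : Integrable (Function.uncurry fun x ξ : ℝ =>
      Φ (x, ξ / x) * ((|x| : ℝ) : ℂ)⁻¹ * expChar (ξ * s)) (volume.prod volume) :=
    (integrable_orbit_integrand Φ).mul_expChar (measurable_snd.mul_const s)
  rw [fourier_eq_integral_expChar]
  simp only [orbInt, ← integral_mul_const]
  rw [← integral_integral_swap hint]
  refine integral_congr_ae ?_
  filter_upwards [hne] with x hx0
  have hx : ((|x| : ℝ) : ℂ) ≠ 0 := Complex.ofReal_ne_zero.2 (abs_ne_zero.2 hx0)
  have key := Measure.integral_comp_div (fun y => Φ (x, y) * expChar (x * y * s)) x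
  rw [Complex.real_smul] at key
  rw [← mul_right_inj' hx, ← key, ← integral_const_mul]
  refine integral_congr_ae (.of_forall fun ξ => ?_)
  simp only [mul_div_cancel₀ ξ hx0]
  field_simp

/-- Fourier inversion in the second variable of the symplectic Fourier transform. -/
lemma integral_symplFT_mul_expChar (Φ : SchwartzMap (ℝ × ℝ) ℂ) (u w : ℝ) :
    ∫ v : ℝ, symplFT Φ (u, v) * expChar (v * w) = ∫ y : ℝ, Φ (-w, y) * expChar (-(y * u)) := by
  set P : ℝ → ℂ := fun x => ∫ y : ℝ, Φ (x, y) * expChar (-(y * u)) with hP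
  have hΦ : Integrable Φ (volume.prod volume) := Φ.integrable
  have hPint : Integrable P := by
    have hm : Measurable fun p : ℝ × ℝ => -(p.2 * u) := by fun_prop
    exact (hΦ.mul_expChar hm).integral_prod_left
  have hPcont : Continuous P := by
    have hc := Φ.continuous
    have he := continuous_expChar
    obtain ⟨C, hC⟩ := Φ.exists_bound_snd
    refine continuous_of_dominated (bound := fun y => C * (1 + y ^ 2)⁻¹) (fun x => ?_)
      (fun x => .of_forall fun y => ?_) (integrable_inv_one_add_sq.const_mul C)
      (.of_forall fun y => by fun_prop)
    · exact Continuous.aestronglyMeasurable (by fun_prop)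
    · rw [norm_mul, norm_expChar, mul_one]
      exact hC x y
  have hF : 𝓕 P = fun v => symplFT Φ (u, v) := by
    ext v
    have hm : Measurable fun q : ℝ × ℝ => q.1 * v - q.2 * u := by fun_prop
    rw [fourier_eq_integral_expChar, symplFT_apply, Measure.volume_eq_prod,
      integral_prod _ (hΦ.mul_expChar hm)]
    simp only [hP, ← integral_mul_const, mul_assoc, ← expChar_add]
    simp only [neg_add_eq_sub]
  have hFint : Integrable (𝓕 P) := by
    obtain ⟨G, hG⟩ := exists_schwartzMap_eq_symplFT Φ
    obtain ⟨C, hC⟩ := G.exists_bound_snd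
    rw [hF, ← hG]
    have hc := G.continuous
    exact (integrable_inv_one_add_sq.const_mul C).mono'
      (Continuous.aestronglyMeasurable (by fun_prop)) (.of_forall fun v => hC u v)
  have hinv := hPint.fourierInv_fourier_eq hFint (v := -w) hPcont.continuousAt
  rw [Real.fourierInv_eq_fourier_neg, neg_neg, fourier_eq_integral_expChar, hF] at hinv
  exact hinv

/-- The Fourier transform intertwines the symplectic Fourier transform with inversion of the
frequency variable on orbital integrals. -/
lemma fourier_orbInt_eq_of_eq_symplFT (Φ G : SchwartzMap (ℝ × ℝ) ℂ) (hG : ⇑G = symplFT Φ)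
    {s : ℝ} (hs : s ≠ 0) :
    𝓕 (orbInt G) s = |s⁻¹| • 𝓕 (orbInt Φ) s⁻¹ := by
  have key := Measure.integral_comp_mul_left
    (fun x => ∫ y : ℝ, Φ (x, y) * expChar (x * y * s⁻¹)) (-s)
  rw [inv_neg, abs_neg] at key
  rw [fourier_orbInt, fourier_orbInt, ← key]
  refine integral_congr_ae (.of_forall fun u => ?_)
  have h := integral_symplFT_mul_expChar Φ u (u * s)
  simp only [hG]
  calc ∫ v : ℝ, symplFT Φ (u, v) * expChar (u * v * s)
      = ∫ v : ℝ, symplFT Φ (u, v) * expChar (v * (u * s)) := by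
        congr 1 with v
        ring_nf
    _ = ∫ y : ℝ, Φ (-(u * s), y) * expChar (-(y * u)) := h
    _ = ∫ y : ℝ, Φ (-s * u, y) * expChar (-s * u * y * s⁻¹) := by
        congr 1 with y
        congr 2
        · ring_nf
        · field_simp

lemma orbInt_eq_zero_of_fourier_eq_zero (Φ : SchwartzMap (ℝ × ℝ) ℂ)
    (h : ∀ s : ℝ, s ≠ 0 → 𝓕 (orbInt Φ) s = 0) {ξ : ℝ} (hξ : ξ ≠ 0) : orbInt Φ ξ = 0 := by
  have h0 : 𝓕 (orbInt Φ) =ᵐ[volume] 0 := by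
    filter_upwards [Real.ae_ne_zero] with s hs using h s hs
  have hinv := (integrable_orbInt Φ).fourierInv_fourier_eq
    ((integrable_zero _ _ _).congr h0.symm) (continuousAt_orbInt Φ hξ)
  rw [← hinv, Real.fourierInv_congr_ae h0, Real.fourierInv_eq_fourier_neg,
    fourier_eq_integral_expChar]
  simp

/-- If two Schwartz functions on `ℝ²` have equal split orbital integrals, so do their
symplectic Fourier transforms. -/
theorem stmt_5 (Φ₁ Φ₂ : SchwartzMap (ℝ × ℝ) ℂ)
    (h : ∀ ξ : ℝ, ξ ≠ 0 → orbInt Φ₁ ξ = orbInt Φ₂ ξ) :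
    ∀ ξ : ℝ, ξ ≠ 0 → orbInt (symplFT Φ₁) ξ = orbInt (symplFT Φ₂) ξ := by
  intro ξ hξ
  obtain ⟨G₁, hG₁⟩ := exists_schwartzMap_eq_symplFT Φ₁
  obtain ⟨G₂, hG₂⟩ := exists_schwartzMap_eq_symplFT Φ₂
  have hG : ⇑(G₁ - G₂) = symplFT (Φ₁ - Φ₂ : SchwartzMap (ℝ × ℝ) ℂ) := by
    ext p
    rw [symplFT_sub, ← hG₁, ← hG₂]
    simp
  have h0 : orbInt (Φ₁ - Φ₂ : SchwartzMap (ℝ × ℝ) ℂ) =ᵐ[volume] 0 := by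
    filter_upwards [Real.ae_ne_zero] with η hη
    rw [orbInt_sub Φ₁ Φ₂ hη, h η hη, sub_self, Pi.zero_apply]
  rw [← hG₁, ← hG₂, ← sub_eq_zero, ← orbInt_sub G₁ G₂ hξ]
  refine orbInt_eq_zero_of_fourier_eq_zero _ (fun s hs => ?_) hξ
  rw [fourier_orbInt_eq_of_eq_symplFT _ _ hG hs, Real.fourier_congr_ae h0,
    fourier_eq_integral_expChar]
  simp
end

section
/- Let Φ : ℝ² → ℂ be a Schwartz function. For every ξ ≠ 0 the split orbital integral O_ξ(Φ) = ∫_ℝ Φ(u, ξ/u) |u|^{-1} du converges absolutely, and there exist ε > 0 and smooth functions C_1, C_2 : ℝ → ℂ such that O_ξ(Φ) = C_1(ξ) + C_2(ξ)·log|ξ| for all ξ with 0 < |ξ| < ε, and moreover C_2(0) = −2·Φ(0,0). -/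
open MeasureTheory
open scoped SchwartzMap FourierTransform LineDeriv ContDiff Topology

noncomputable section

namespace SplitOrbital

/-- The partial derivative of a Schwartz function on the plane in the first variable. -/
def partialX (Φ : 𝓢(ℝ × ℝ, ℂ)) : 𝓢(ℝ × ℝ, ℂ) := ∂_{((1 : ℝ), (0 : ℝ))} Φ

/-- The partial derivative of a Schwartz function on the plane in the second variable. -/
def partialY (Φ : 𝓢(ℝ × ℝ, ℂ)) : 𝓢(ℝ × ℝ, ℂ) := ∂_{((0 : ℝ), (1 : ℝ))} Φ

theorem hasDerivAt_partialX (Φ : 𝓢(ℝ × ℝ, ℂ)) (x y : ℝ) :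
    HasDerivAt (fun x => Φ (x, y)) (partialX Φ (x, y)) x := by
  have h := (Φ.differentiableAt (x := (x, y))).hasFDerivAt.comp_hasDerivAt x
    ((hasDerivAt_id x).prodMk (hasDerivAt_const x y))
  rwa [← SchwartzMap.lineDerivOp_apply_eq_fderiv] at h

theorem hasDerivAt_partialY (Φ : 𝓢(ℝ × ℝ, ℂ)) (x y : ℝ) :
    HasDerivAt (fun y => Φ (x, y)) (partialY Φ (x, y)) y := by
  have h := (Φ.differentiableAt (x := (x, y))).hasFDerivAt.comp_hasDerivAt y
    ((hasDerivAt_const y x).prodMk (hasDerivAt_id y))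
  rwa [← SchwartzMap.lineDerivOp_apply_eq_fderiv] at h

theorem iteratedDeriv_fst (Φ : 𝓢(ℝ × ℝ, ℂ)) (k : ℕ) (y : ℝ) :
    iteratedDeriv k (fun x => Φ (x, y)) = fun x => (partialX^[k] Φ) (x, y) := by
  induction k with
  | zero => simp
  | succ k ih =>
    rw [iteratedDeriv_succ, ih, Function.iterate_succ_apply']
    exact funext fun x => (hasDerivAt_partialX _ x y).deriv

theorem iteratedDeriv_snd (Φ : 𝓢(ℝ × ℝ, ℂ)) (k : ℕ) (x : ℝ) :
    iteratedDeriv k (fun y => Φ (x, y)) = fun y => (partialY^[k] Φ) (x, y) := by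
  induction k with
  | zero => simp
  | succ k ih =>
    rw [iteratedDeriv_succ, ih, Function.iterate_succ_apply']
    exact funext fun y => (hasDerivAt_partialY _ x y).deriv

/-- The restriction of a Schwartz function on the plane to a vertical line. -/
def slice (x : ℝ) (Φ : 𝓢(ℝ × ℝ, ℂ)) : 𝓢(ℝ, ℂ) :=
  SchwartzMap.compCLMOfAntilipschitz ℝ (K := 1) (g := fun y : ℝ => (x, y))
    (by
      convert! (Function.HasTemperateGrowth.const (x, (0 : ℝ))).add
        (ContinuousLinearMap.inr ℝ ℝ ℝ).hasTemperateGrowth using 1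
      ext <;> simp)
    (AntilipschitzWith.of_le_mul_dist fun a b => by simp [Prod.dist_eq]) Φ

@[simp] theorem slice_apply (x y : ℝ) (Φ : 𝓢(ℝ × ℝ, ℂ)) : slice x Φ y = Φ (x, y) := rfl

theorem exists_decay (Φ : 𝓢(ℝ × ℝ, ℂ)) (n : ℕ) :
    ∃ C, 0 ≤ C ∧ ∀ p, (1 + ‖p‖) ^ n * ‖Φ p‖ ≤ C := by
  have h := fun p => SchwartzMap.one_add_le_sup_seminorm_apply (𝕜 := ℝ) (m := (n, 0))
    le_rfl le_rfl Φ p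
  simp only [norm_iteratedFDeriv_zero] at h
  exact ⟨_, (by positivity : (0 : ℝ) ≤ (1 + ‖(0 : ℝ × ℝ)‖) ^ n * ‖Φ 0‖).trans (h 0), h⟩

theorem exists_decay_snd (Φ : 𝓢(ℝ × ℝ, ℂ)) :
    ∃ C, 0 ≤ C ∧ ∀ x y, ‖Φ (x, y)‖ ≤ C * (1 + y ^ 2)⁻¹ := by
  obtain ⟨C, hC, h⟩ := exists_decay Φ 2
  refine ⟨C, hC, fun x y => ?_⟩
  rw [← div_eq_mul_inv, le_div_iff₀ (by positivity), mul_comm]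
  refine le_trans ?_ (h (x, y))
  have : |y| ≤ ‖(x, y)‖ := le_max_right _ _
  gcongr
  nlinarith [sq_abs y, abs_nonneg y]

/-- The Fourier transform of a Schwartz function on the plane in the second variable. -/
def fourierSnd (Φ : 𝓢(ℝ × ℝ, ℂ)) (x v : ℝ) : ℂ := 𝓕 (slice x Φ) v

theorem fourierSnd_eq (Φ : 𝓢(ℝ × ℝ, ℂ)) (x v : ℝ) :
    fourierSnd Φ x v = ∫ y, Real.fourierChar (-(y * v)) • Φ (x, y) := by
  simp [fourierSnd, SchwartzMap.fourier_coe, Real.fourier_real_eq]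

theorem hasDerivAt_fourierSnd (Φ : 𝓢(ℝ × ℝ, ℂ)) (x v : ℝ) :
    HasDerivAt (fun x => fourierSnd Φ x v) (fourierSnd (partialX Φ) x v) x := by
  obtain ⟨C, hC, hb⟩ := exists_decay_snd (partialX Φ)
  have hcont : ∀ (Ψ : 𝓢(ℝ × ℝ, ℂ)) (x : ℝ),
      Continuous fun y => Real.fourierChar (-(y * v)) • Ψ (x, y) := by
    intro Ψ x
    have := Ψ.continuous
    have := Real.continuous_fourierChar
    fun_prop
  simp_rw [fourierSnd_eq]
  refine (hasDerivAt_integral_of_dominated_loc_of_deriv_le (s := Set.univ)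
    (F' := fun x y => Real.fourierChar (-(y * v)) • partialX Φ (x, y)) Filter.univ_mem
    (.of_forall fun x => (hcont Φ x).aestronglyMeasurable) ?_
      (hcont (partialX Φ) x).aestronglyMeasurable
    (.of_forall fun y x _ => ?_) (integrable_inv_one_add_sq.const_mul C)
    (.of_forall fun y x _ => ?_)).2
  · refine ((slice x Φ).integrable (μ := volume)).mono (hcont Φ x).aestronglyMeasurable
      (.of_forall fun y => ?_)
    simp
  · simpa using hb x y
  · exact (hasDerivAt_partialX Φ x y).const_smul (Real.fourierChar (-(y * v)))

theorem fourierSnd_iterate_partialY (Φ : 𝓢(ℝ × ℝ, ℂ)) (k : ℕ) (x v : ℝ) :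
    fourierSnd (partialY^[k] Φ) x v = (2 * Real.pi * Complex.I * v) ^ k * fourierSnd Φ x v := by
  have hs : ∀ n, iteratedDeriv n (slice x Φ) = slice x (partialY^[n] Φ) := fun n =>
    (iteratedDeriv_snd Φ n x)
  have := congrFun (Real.fourier_iteratedDeriv (N := ⊤) (n := k) ((slice x Φ).smooth _)
    (fun n _ => by rw [hs]; exact SchwartzMap.integrable _) le_top) v
  rw [hs] at this
  simpa [fourierSnd, SchwartzMap.fourier_coe] using this

theorem exists_pow_mul_fourierSnd_le (Φ : 𝓢(ℝ × ℝ, ℂ)) (k : ℕ) :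
    ∃ C, 0 ≤ C ∧ ∀ x v, |v| ^ k * ‖fourierSnd Φ x v‖ ≤ C := by
  obtain ⟨C, hC, hb⟩ := exists_decay_snd (partialY^[k] Φ)
  refine ⟨∫ y : ℝ, C * (1 + y ^ 2)⁻¹, integral_nonneg fun y => by positivity, fun x v => ?_⟩
  calc |v| ^ k * ‖fourierSnd Φ x v‖ ≤ (2 * Real.pi * |v|) ^ k * ‖fourierSnd Φ x v‖ := by
        gcongr
        nlinarith [Real.pi_gt_three, abs_nonneg v]
    _ = ‖fourierSnd (partialY^[k] Φ) x v‖ := by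
        rw [fourierSnd_iterate_partialY]
        simp [Real.pi_pos.le, abs_of_nonneg]
    _ ≤ _ := by
        rw [fourierSnd_eq]
        refine norm_integral_le_of_norm_le (integrable_inv_one_add_sq.const_mul C)
          (.of_forall fun y => ?_)
        simpa using hb x y

theorem exists_pow_mul_fourierSnd_le_inv (Φ : 𝓢(ℝ × ℝ, ℂ)) (k : ℕ) :
    ∃ C, 0 ≤ C ∧ ∀ x v, |v| ^ k * ‖fourierSnd Φ x v‖ ≤ C * (1 + v ^ 2)⁻¹ := by
  obtain ⟨C, hC, h⟩ := exists_pow_mul_fourierSnd_le Φ k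
  obtain ⟨D, hD, h'⟩ := exists_pow_mul_fourierSnd_le Φ (k + 2)
  refine ⟨C + D, by positivity, fun x v => ?_⟩
  rw [← div_eq_mul_inv, le_div_iff₀ (by positivity)]
  have h1 := h x v
  have h2 := h' x v
  rw [pow_add, sq_abs] at h2
  linarith

theorem integrable_pow_mul_fourierSnd (Φ : 𝓢(ℝ × ℝ, ℂ)) (k : ℕ) (x : ℝ) :
    Integrable fun v : ℝ => (v : ℂ) ^ k * fourierSnd Φ x v := by
  obtain ⟨C, hC, h⟩ := exists_pow_mul_fourierSnd_le_inv Φ k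
  refine (integrable_inv_one_add_sq.const_mul C).mono' ?_ (.of_forall fun v => ?_)
  · have := (𝓕 (slice x Φ)).continuous
    unfold fourierSnd
    exact (by fun_prop : Continuous _).aestronglyMeasurable
  · simpa using h x v

/-- Fourier inversion in the second variable at `y = 0`. -/
theorem integral_pow_mul_fourierSnd_eq_zero (Φ : 𝓢(ℝ × ℝ, ℂ)) (k : ℕ) (x : ℝ)
    (h : (partialY^[k] Φ) (x, 0) = 0) : ∫ v : ℝ, (v : ℂ) ^ k * fourierSnd Φ x v = 0 := by
  have h1 : ∫ v : ℝ, fourierSnd (partialY^[k] Φ) x v = 0 := by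
    have := congrArg (fun f : 𝓢(ℝ, ℂ) => f 0)
      (FourierTransform.fourierInv_fourier_eq (F := 𝓢(ℝ, ℂ)) (slice x (partialY^[k] Φ)))
    simp only [slice_apply, h, SchwartzMap.fourierInv_coe, Real.fourierInv_eq] at this
    simpa [fourierSnd] using this
  simp_rw [fourierSnd_iterate_partialY, mul_pow, mul_assoc] at h1
  simp_rw [integral_const_mul] at h1
  simpa [Real.pi_ne_zero] using h1

/-- A crude Taylor estimate along a sequence of successive derivatives. -/
theorem norm_sub_sum_taylor_le (N : ℕ) (h : ℕ → ℝ → ℂ) (B : ℝ)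
    (hd : ∀ k x, HasDerivAt (h k) (h (k + 1) x) x) (hB : ∀ x, ‖h N x‖ ≤ B) (x : ℝ) :
    ‖h 0 x - ∑ k ∈ Finset.range N, ((x : ℂ) ^ k / k.factorial) * h k 0‖ ≤ B * |x| ^ N := by
  induction N generalizing h x with
  | zero => simpa using hB x
  | succ N ih =>
    have key := ih (fun k => h (k + 1)) (fun k x => hd (k + 1) x) hB
    set R : ℝ → ℂ :=
        fun x => h 0 x - ∑ k ∈ Finset.range (N + 1), ((x : ℂ) ^ k / k.factorial) * h k 0
    have hR : ∀ t, HasDerivAt R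
        (h 1 t - ∑ k ∈ Finset.range N, ((t : ℂ) ^ k / k.factorial) * h (k + 1) 0) t := by
      intro t
      refine (hd 0 t).sub ?_
      simp_rw [Finset.sum_range_succ' _ N]
      simp only [pow_zero]
      refine HasDerivAt.add_const _ (HasDerivAt.fun_sum fun k _ => ?_)
      have := ((((hasDerivAt_id t).ofReal_comp).pow (k + 1)).div_const
        ((k + 1).factorial : ℂ)).mul_const (h (k + 1) 0)
      convert! this using 1
      have : ((k : ℂ) + 1) ≠ 0 := by exact_mod_cast k.succ_ne_zero
      have : (k.factorial : ℂ) ≠ 0 := by exact_mod_cast k.factorial_ne_zero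
      push_cast [Nat.factorial_succ]
      simp only [id, mul_one]
      field_simp
    have h0 : R 0 = 0 := by simp [R, Finset.sum_range_succ']
    have := (convex_uIcc (0 : ℝ) x).norm_image_sub_le_of_norm_hasDerivWithin_le
      (f := R) (C := B * |x| ^ N) (fun t _ => (hR t).hasDerivWithinAt) (fun t ht => ?_)
      Set.left_mem_uIcc Set.right_mem_uIcc
    · simpa [h0, pow_succ, mul_assoc] using this
    · refine (key t).trans ?_
      have hB0 : 0 ≤ B := (norm_nonneg _).trans (hB 0)
      have : |t| ≤ |x| := by simpa using Set.abs_sub_left_of_mem_uIcc ht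
      gcongr

/-- The integrand of the split orbital integral. -/
def orbitalIntegrand (Φ : 𝓢(ℝ × ℝ, ℂ)) (ξ u : ℝ) : ℂ := Φ (u, ξ / u) * ((|u| : ℝ) : ℂ)⁻¹

/-- The split orbital integral of a Schwartz function on the plane. -/
def orbital (Φ : 𝓢(ℝ × ℝ, ℂ)) (ξ : ℝ) : ℂ := ∫ u, orbitalIntegrand Φ ξ u

theorem measurable_orbitalIntegrand (Φ : 𝓢(ℝ × ℝ, ℂ)) :
    Measurable fun q : ℝ × ℝ => orbitalIntegrand Φ q.1 q.2 := by
  have := Φ.continuous.measurable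
  unfold orbitalIntegrand
  fun_prop

theorem exists_orbitalIntegrand_le (Φ : 𝓢(ℝ × ℝ, ℂ)) :
    ∃ C, 0 ≤ C ∧ ∀ ξ u, ξ ≠ 0 → ‖orbitalIntegrand Φ ξ u‖ ≤ C / |ξ| * (1 + u ^ 2)⁻¹ := by
  obtain ⟨C, hC, h⟩ := exists_decay Φ 3
  refine ⟨C, hC, fun ξ u hξ => ?_⟩
  rcases eq_or_ne u 0 with rfl | hu
  · simp [orbitalIntegrand]
    positivity
  have hu' := abs_pos.2 hu
  have hξ' := abs_pos.2 hξ
  have key : (1 + u ^ 2) * |ξ / u| * ‖Φ (u, ξ / u)‖ ≤ C := by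
    refine le_trans ?_ (h (u, ξ / u))
    have h1 : |u| ≤ ‖(u, ξ / u)‖ := le_max_left _ _
    have h2 : |ξ / u| ≤ ‖(u, ξ / u)‖ := le_max_right _ _
    rw [pow_succ (1 + ‖(u, ξ / u)‖) 2]
    gcongr
    · nlinarith [sq_abs u, abs_nonneg u]
    · linarith
  rw [← div_eq_mul_inv, div_div, le_div_iff₀ (by positivity)]
  simp only [orbitalIntegrand, norm_mul, norm_inv, Complex.norm_real, Real.norm_eq_abs,
    abs_abs]
  rw [abs_div] at key
  calc _ = (1 + u ^ 2) * (|ξ| / |u|) * ‖Φ (u, ξ / u)‖ := by ring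
    _ ≤ C := key

theorem integrable_orbitalIntegrand (Φ : 𝓢(ℝ × ℝ, ℂ)) {ξ : ℝ} (hξ : ξ ≠ 0) :
    Integrable (orbitalIntegrand Φ ξ) := by
  obtain ⟨C, hC, h⟩ := exists_orbitalIntegrand_le Φ
  exact (integrable_inv_one_add_sq.const_mul (C / |ξ|)).mono'
    ((measurable_orbitalIntegrand Φ).comp measurable_prodMk_left).aestronglyMeasurable
    (.of_forall fun u => h ξ u hξ)

theorem continuousAt_orbital (Φ : 𝓢(ℝ × ℝ, ℂ)) {ξ : ℝ} (hξ : ξ ≠ 0) :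
    ContinuousAt (orbital Φ) ξ := by
  obtain ⟨C, hC, h⟩ := exists_orbitalIntegrand_le Φ
  have hξ' := abs_pos.2 hξ
  refine continuousAt_of_dominated (bound := fun u => C / (|ξ| / 2) * (1 + u ^ 2)⁻¹)
    (.of_forall fun ζ =>
      ((measurable_orbitalIntegrand Φ).comp measurable_prodMk_left).aestronglyMeasurable) ?_
    (integrable_inv_one_add_sq.const_mul _) (.of_forall fun u => ?_)
  · have : ∀ᶠ ζ in 𝓝 ξ, |ξ| / 2 < |ζ| :=
      continuous_abs.continuousAt.eventually (lt_mem_nhds (by linarith))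
    filter_upwards [this] with ζ hζ
    refine .of_forall fun u => (h ζ u (abs_pos.1 (by linarith))).trans ?_
    gcongr
  · have := Φ.continuous
    unfold orbitalIntegrand
    fun_prop

theorem integral_norm_comp_div (Φ : 𝓢(ℝ × ℝ, ℂ)) {u : ℝ} (hu : u ≠ 0) :
    ∫ ξ, ‖orbitalIntegrand Φ ξ u‖ = ∫ y, ‖Φ (u, y)‖ := by
  simp only [orbitalIntegrand, norm_mul, integral_mul_const]
  rw [Measure.integral_comp_div (fun y => ‖Φ (u, y)‖) u]
  have := abs_pos.2 hu
  simp
  field_simp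

theorem integrable_prod_orbitalIntegrand (Φ : 𝓢(ℝ × ℝ, ℂ)) :
    Integrable (fun q : ℝ × ℝ => orbitalIntegrand Φ q.1 q.2) (volume.prod volume) := by
  have hne : ∀ᵐ u : ℝ, u ≠ 0 := Measure.ae_ne volume 0
  rw [integrable_prod_iff' (measurable_orbitalIntegrand Φ).aestronglyMeasurable]
  constructor
  · filter_upwards [hne] with u hu
    exact (((slice u Φ).integrable (μ := volume)).comp_div hu).mul_const _
  · have h : Integrable fun u : ℝ => ∫ y, ‖Φ (u, y)‖ :=
      ((SchwartzMap.integrable (μ := volume) Φ).norm).integral_prod_left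
    refine h.congr ?_
    filter_upwards [hne] with u hu
    exact (integral_norm_comp_div Φ hu).symm

theorem integrable_orbital (Φ : 𝓢(ℝ × ℝ, ℂ)) : Integrable (orbital Φ) :=
  (integrable_prod_orbitalIntegrand Φ).integral_prod_left

/-- The Fourier transform of the orbital integral, computed along the lines `v = τ u`. -/
theorem fourier_orbital (Φ : 𝓢(ℝ × ℝ, ℂ)) (τ : ℝ) :
    𝓕 (orbital Φ) τ = ∫ u, fourierSnd Φ u (τ * u) := by
  have hint : Integrable (fun q : ℝ × ℝ =>
      Real.fourierChar (-(q.1 * τ)) • orbitalIntegrand Φ q.1 q.2) (volume.prod volume) := by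
    refine (integrable_prod_orbitalIntegrand Φ).mono ?_ (.of_forall fun q => by simp)
    have := measurable_orbitalIntegrand Φ
    have h2 : Continuous fun q : ℝ × ℝ => ((Real.fourierChar (-(q.1 * τ)) : Circle) : ℂ) := by
      have := Real.continuous_fourierChar
      fun_prop
    exact (h2.measurable.mul this).aestronglyMeasurable
  rw [Real.fourier_real_eq]
  calc ∫ ξ, Real.fourierChar (-(ξ * τ)) • orbital Φ ξ
      = ∫ ξ, ∫ u, Real.fourierChar (-(ξ * τ)) • orbitalIntegrand Φ ξ u := by
        simp only [orbital, Circle.smul_def, integral_smul]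
    _ = ∫ u, ∫ ξ, Real.fourierChar (-(ξ * τ)) • orbitalIntegrand Φ ξ u :=
        integral_integral_swap hint
    _ = _ := by
        refine integral_congr_ae ?_
        filter_upwards [Measure.ae_ne volume (0 : ℝ)] with u hu
        have := Measure.integral_comp_div
          (fun y => Real.fourierChar (-(y * (τ * u))) • Φ (u, y)) u
        rw [fourierSnd_eq]
        have hu' : ((|u| : ℝ) : ℂ) ≠ 0 := by exact_mod_cast (abs_pos.2 hu).ne'
        calc _ = (∫ ξ, Real.fourierChar (-(ξ / u * (τ * u))) • Φ (u, ξ / u)) *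
              ((|u| : ℝ) : ℂ)⁻¹ := by
              rw [← integral_mul_const]
              refine integral_congr_ae (.of_forall fun ξ => ?_)
              have : ξ / u * (τ * u) = ξ * τ := by field_simp
              simp only [orbitalIntegrand, this, Circle.smul_def, smul_eq_mul, mul_assoc]
          _ = _ := by
              rw [this, Complex.real_smul, mul_comm, inv_mul_cancel_left₀ hu']

/-- The Fourier transform of the orbital integral decays rapidly when the mixed derivatives
`∂ₓᵏ∂ᵧᵏ Φ` vanish at the origin. -/
theorem exists_fourier_orbital_le (Φ : 𝓢(ℝ × ℝ, ℂ))
    (hΦ : ∀ k, (partialY^[k] (partialX^[k] Φ)) (0, 0) = 0) (N : ℕ) :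
    ∃ C, 0 ≤ C ∧ ∀ τ, |τ| ^ (N + 1) * ‖𝓕 (orbital Φ) τ‖ ≤ C := by
  obtain ⟨C, hC, hb⟩ := exists_pow_mul_fourierSnd_le_inv (partialX^[N] Φ) N
  refine ⟨∫ v : ℝ, C * (1 + v ^ 2)⁻¹, integral_nonneg fun y => by positivity, fun τ => ?_⟩
  rcases eq_or_ne τ 0 with rfl | hτ
  · simpa using integral_nonneg fun y : ℝ => by positivity
  have hτ' := abs_pos.2 hτ
  have heq : ∀ (k : ℕ) (u : ℝ),
      ((u : ℂ) ^ k / k.factorial) * fourierSnd (partialX^[k] Φ) 0 (τ * u) =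
      (((τ : ℂ) ^ k)⁻¹ / k.factorial) *
        (((τ * u : ℝ) : ℂ) ^ k * fourierSnd (partialX^[k] Φ) 0 (τ * u)) := by
    intro k u
    have : (τ : ℂ) ≠ 0 := by exact_mod_cast hτ
    push_cast
    rw [mul_pow]
    field_simp
  have hi : ∀ k, Integrable fun u : ℝ =>
      ((u : ℂ) ^ k / k.factorial) * fourierSnd (partialX^[k] Φ) 0 (τ * u) := by
    intro k
    simp_rw [heq]
    exact ((integrable_pow_mul_fourierSnd (partialX^[k] Φ) k 0).comp_mul_left' hτ).const_mul _
  set T : ℝ → ℂ := fun u => ∑ k ∈ Finset.range N,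
      ((u : ℂ) ^ k / k.factorial) * fourierSnd (partialX^[k] Φ) 0 (τ * u) with hTdef
  have hTi : Integrable T := integrable_finsetSum _ fun k _ => hi k
  have hT : ∫ u : ℝ, T u = 0 := by
    have h1 (k : ℕ) := Measure.integral_comp_mul_left
      (fun v : ℝ => (v : ℂ) ^ k * fourierSnd (partialX^[k] Φ) 0 v) τ
    simp_rw [integral_pow_mul_fourierSnd_eq_zero _ _ 0 (hΦ _), smul_zero] at h1
    rw [hTdef, integral_finsetSum _ fun k _ => hi k]
    simp_rw [heq, integral_const_mul, h1, mul_zero, Finset.sum_const_zero]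
  rw [fourier_orbital]
  by_cases hG : Integrable fun u => fourierSnd Φ u (τ * u)
  swap
  · rw [integral_undef hG]
    simpa using integral_nonneg fun y : ℝ => by positivity
  have hle : ∀ᵐ u : ℝ, ‖fourierSnd Φ u (τ * u) - T u‖ ≤
      (|τ| ^ N)⁻¹ * (C * (1 + (τ * u) ^ 2)⁻¹) := by
    filter_upwards [Measure.ae_ne volume (0 : ℝ)] with u hu
    have hu' := abs_pos.2 hu
    have := norm_sub_sum_taylor_le N (fun k x => fourierSnd (partialX^[k] Φ) x (τ * u))
      (C * (1 + (τ * u) ^ 2)⁻¹ / |τ * u| ^ N)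
      (fun k x => by
        rw [Function.iterate_succ_apply']
        exact hasDerivAt_fourierSnd _ x _)
      (fun x => by
        rw [le_div_iff₀' (by rw [abs_mul]; positivity)]
        exact hb x (τ * u)) u
    refine this.trans_eq ?_
    rw [abs_mul, mul_pow |τ|]
    field_simp
  have hI := ((integrable_inv_one_add_sq.const_mul C).comp_mul_left' hτ).const_mul (|τ| ^ N)⁻¹
  calc |τ| ^ (N + 1) * ‖∫ u, fourierSnd Φ u (τ * u)‖
      = |τ| ^ (N + 1) * ‖∫ u, (fourierSnd Φ u (τ * u) - T u)‖ := by
        rw [integral_sub hG hTi, hT, sub_zero]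
    _ ≤ |τ| ^ (N + 1) * ∫ u, (|τ| ^ N)⁻¹ * (C * (1 + (τ * u) ^ 2)⁻¹) := by
        gcongr
        exact norm_integral_le_of_norm_le hI hle
    _ = _ := by
        rw [integral_const_mul,
          Measure.integral_comp_mul_left (fun v : ℝ => C * (1 + v ^ 2)⁻¹) τ, smul_eq_mul, abs_inv,
          pow_succ]
        field_simp

/-- If the mixed derivatives `∂ₓᵏ∂ᵧᵏ Φ` vanish at the origin, the orbital integral extends smoothly
through `0`. -/
theorem exists_contDiff_eq_orbital (Φ : 𝓢(ℝ × ℝ, ℂ))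
    (hΦ : ∀ k, (partialY^[k] (partialX^[k] Φ)) (0, 0) = 0) :
    ∃ F : ℝ → ℂ, ContDiff ℝ ∞ F ∧ ∀ ξ, ξ ≠ 0 → orbital Φ ξ = F ξ := by
  have hcont : Continuous (𝓕 (orbital Φ)) :=
    VectorFourier.fourierIntegral_continuous Real.continuous_fourierChar
      (by exact continuous_inner) (integrable_orbital Φ)
  have hbound : ∀ n : ℕ, ∃ C, ∀ τ : ℝ, |τ| ^ n * ‖𝓕 (orbital Φ) τ‖ ≤ C := by
    intro n
    cases n with
    | zero =>
      refine ⟨∫ ξ, ‖orbital Φ ξ‖, fun τ => ?_⟩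
      rw [pow_zero, one_mul]
      exact VectorFourier.norm_fourierIntegral_le_integral_norm _ _ _ _ _
    | succ n =>
      obtain ⟨C, -, h⟩ := exists_fourier_orbital_le Φ hΦ n
      exact ⟨C, h⟩
  have hint : ∀ n : ℕ, Integrable fun τ : ℝ => ‖τ‖ ^ n * ‖𝓕 (orbital Φ) τ‖ := by
    intro n
    obtain ⟨C, h⟩ := hbound n
    obtain ⟨D, h'⟩ := hbound (n + 2)
    refine (integrable_inv_one_add_sq.const_mul (C + D)).mono'
      (by fun_prop : Continuous _).aestronglyMeasurable (.of_forall fun τ => ?_)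
    rw [← div_eq_mul_inv, le_div_iff₀ (by positivity), Real.norm_of_nonneg (by positivity)]
    have h1 := h τ
    have h2 := h' τ
    rw [pow_add, sq_abs] at h2
    simp only [Real.norm_eq_abs]
    linarith
  have hint0 : Integrable (𝓕 (orbital Φ)) := by
    have := hint 0
    simp only [pow_zero, one_mul] at this
    exact (integrable_norm_iff hcont.aestronglyMeasurable).1 this
  refine ⟨𝓕⁻ (𝓕 (orbital Φ)), ?_, fun ξ hξ => ?_⟩
  · have : 𝓕⁻ (𝓕 (orbital Φ)) = fun ξ => 𝓕 (𝓕 (orbital Φ)) (-ξ) :=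
      funext fun ξ => Real.fourierInv_eq_fourier_neg _ ξ
    rw [this]
    exact (Real.contDiff_fourier fun n _ => hint n).comp contDiff_neg
  · exact ((integrable_orbital Φ).fourierInv_fourier_eq hint0 (continuousAt_orbital Φ hξ)).symm

/-- The smooth cutoff on the line equal to `1` on `[-1, 1]` and supported in `[-2, 2]`. -/
def cutoff : ContDiffBump (0 : ℝ) := ⟨1, 2, one_pos, one_lt_two⟩

theorem cutoff_eq_one {x : ℝ} (hx : |x| ≤ 1) : cutoff x = 1 :=
  cutoff.one_of_mem_closedBall (by simpa [cutoff] using hx)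

theorem cutoff_eq_zero {x : ℝ} (hx : 2 ≤ |x|) : cutoff x = 0 :=
  cutoff.zero_of_le_dist (by simpa [cutoff] using hx)

/-- The monomial `xⁿ / n!`, cut off away from the origin. -/
def cutMonomial (n : ℕ) (x : ℝ) : ℝ := cutoff x * (x ^ n / n.factorial)

theorem contDiff_cutMonomial (n : ℕ) {m : ℕ∞} : ContDiff ℝ m (cutMonomial n) :=
  cutoff.contDiff.mul ((contDiff_id.pow n).div_const _)

theorem exists_iteratedDeriv_cutMonomial_le (j n : ℕ) :
    ∃ M, ∀ x, ‖iteratedDeriv j (cutMonomial n) x‖ ≤ M := by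
  have hs : HasCompactSupport (iteratedFDeriv ℝ j (cutMonomial n)) :=
    HasCompactSupport.iteratedFDeriv (cutoff.hasCompactSupport.mul_right) j
  obtain ⟨M, hM⟩ := hs.exists_bound_of_continuous
    ((contDiff_cutMonomial n (m := ⊤)).continuous_iteratedFDeriv (by exact_mod_cast le_top))
  exact ⟨M, fun x => by rw [← norm_iteratedFDeriv_eq_norm_iteratedDeriv]; exact hM x⟩

theorem iteratedDeriv_cutMonomial_zero (j n : ℕ) :
    iteratedDeriv j (cutMonomial n) 0 = if j = n then 1 else 0 := by
  have : cutMonomial n =ᶠ[𝓝 0] fun x => x ^ n / n.factorial := by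
    filter_upwards [cutoff.eventuallyEq_one] with x hx
    simp [cutMonomial, hx]
  rw [this.iteratedDeriv_eq, iteratedDeriv_div_const, iteratedDeriv_fun_pow_zero]
  split_ifs with h
  · exact div_self (by exact_mod_cast n.factorial_ne_zero)
  · simp

/-- **Borel's lemma**: every sequence is the sequence of derivatives at `0` of a smooth function. -/
theorem exists_contDiff_iteratedDeriv_zero_eq (a : ℕ → ℂ) :
    ∃ f : ℝ → ℂ, ContDiff ℝ ∞ f ∧ ∀ k, iteratedDeriv k f 0 = a k := by
  choose M hM using exists_iteratedDeriv_cutMonomial_le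
  have hM0 : ∀ j n, 0 ≤ M j n := fun j n => (norm_nonneg _).trans (hM j n 0)
  set L : ℕ → ℝ := fun n => 1 + 2 ^ n * ‖a n‖ * ∑ j ∈ Finset.range n, M j n
  have hL1 : ∀ n, 1 ≤ L n := fun n => le_add_of_nonneg_right
    (mul_nonneg (by positivity) (Finset.sum_nonneg fun j _ => hM0 j n))
  have hL0 : ∀ n, 0 < L n := fun n => one_pos.trans_le (hL1 n)
  set f : ℕ → ℝ → ℂ := fun n x => cutMonomial n (L n * x) • (a n / (L n : ℂ) ^ n)
  have hcomp : ∀ n {m : ℕ∞}, ContDiff ℝ m fun x => cutMonomial n (L n * x) := fun n m =>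
    (contDiff_cutMonomial n).comp (contDiff_const.mul contDiff_id)
  have hf : ∀ n {m : ℕ∞}, ContDiff ℝ m (f n) := fun n m => (hcomp n).smul contDiff_const
  have hderiv : ∀ j n x, iteratedDeriv j (f n) x =
      (L n ^ j * iteratedDeriv j (cutMonomial n) (L n * x)) • (a n / (L n : ℂ) ^ n) := by
    intro j n x
    rw [iteratedDeriv_smul_const (hcomp n (m := j)).contDiffAt,
      iteratedDeriv_comp_const_mul (contDiff_cutMonomial n (m := j))]
  set v : ℕ → ℕ → ℝ := fun j n => L n ^ j * M j n * (‖a n‖ / L n ^ n)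
  have hbound : ∀ (j n : ℕ) (x : ℝ), ((j : ℕ∞) ≤ ⊤) → ‖iteratedFDeriv ℝ j (f n) x‖ ≤ v j n := by
    intro j n x _
    rw [norm_iteratedFDeriv_eq_norm_iteratedDeriv, hderiv, norm_smul, norm_mul, norm_div, norm_pow,
      norm_pow, Complex.norm_real, Real.norm_of_nonneg (hL0 n).le]
    have := hL0 n
    change _ ≤ L n ^ j * M j n * (‖a n‖ / L n ^ n)
    gcongr
    exact hM j n _
  have hsum : ∀ j : ℕ, ((j : ℕ∞) ≤ ⊤) → Summable (v j) := by
    intro j _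
    refine Summable.of_norm_bounded_eventually_nat summable_geometric_two ?_
    filter_upwards [Filter.eventually_gt_atTop j] with n hn
    have h0 := hL0 n
    have hMj := hM0 j n
    rw [Real.norm_of_nonneg (by positivity)]
    have h1 : 2 ^ n * ‖a n‖ * M j n ≤ L n := by
      have : M j n ≤ ∑ j ∈ Finset.range n, M j n :=
        Finset.single_le_sum (f := fun j => M j n) (fun i _ => hM0 i n) (Finset.mem_range.2 hn)
      calc _ ≤ 2 ^ n * ‖a n‖ * ∑ j ∈ Finset.range n, M j n := by gcongr
        _ ≤ L n := by simp [L]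
    have h2 : L n ^ j * L n ≤ L n ^ n := by
      rw [← pow_succ]
      exact pow_le_pow_right₀ (hL1 n) hn
    calc v j n = L n ^ j * (M j n * ‖a n‖) / L n ^ n := by ring
      _ ≤ L n ^ j * ((1 / 2) ^ n * L n) / L n ^ n := by
        have h3 : M j n * ‖a n‖ ≤ (1 / 2) ^ n * L n := by
          rw [one_div, inv_pow, inv_mul_eq_div, le_div_iff₀ (by positivity)]
          linarith
        gcongr L n ^ j * ?_ / L n ^ n
      _ = (1 / 2) ^ n * (L n ^ j * L n / L n ^ n) := by ring
      _ ≤ (1 / 2) ^ n * 1 := by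
        gcongr
        exact div_le_one_of_le₀ h2 (by positivity)
      _ = _ := mul_one _
  refine ⟨fun x => ∑' n, f n x, contDiff_tsum (N := ⊤) (fun n => hf n) hsum hbound, fun k => ?_⟩
  have hk := congrFun (iteratedFDeriv_tsum (N := ⊤) (fun n => hf n) hsum hbound (k := k) le_top) 0
  have hs : Summable fun n => iteratedFDeriv ℝ k (f n) 0 :=
    .of_norm_bounded (hsum k le_top) fun n => hbound k n 0 le_top
  rw [iteratedDeriv_eq_iteratedFDeriv, hk,
    ContinuousMultilinearMap.tsum_eval hs]
  simp_rw [← iteratedDeriv_eq_iteratedFDeriv, hderiv, mul_zero, iteratedDeriv_cutMonomial_zero]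
  rw [tsum_eq_single k fun n hn => by simp [hn.symm]]
  have : (L k : ℂ) ≠ 0 := by exact_mod_cast (hL0 k).ne'
  simp
  field_simp

theorem integrable_of_bounded_of_eq_zero {f : ℝ → ℝ} {R C : ℝ} (hf : Measurable f)
    (hC : ∀ x, |f x| ≤ C) (hR : ∀ x, R < |x| → f x = 0) : Integrable f := by
  have h0 : 0 ≤ C := (abs_nonneg _).trans (hC 0)
  refine Integrable.mono' (g := (Metric.closedBall (0 : ℝ) R).indicator fun _ => C) ?_
    hf.aestronglyMeasurable (.of_forall fun x => ?_)
  · exact (integrable_indicator_iff measurableSet_closedBall).2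
      (integrableOn_const (isCompact_closedBall _ _).measure_lt_top.ne)
  · by_cases hx : R < |x|
    · simpa [hR x hx] using Set.indicator_nonneg (fun _ _ => h0) x
    · rw [Set.indicator_of_mem (by simpa using hx)]
      exact hC x

/-- The indicator function of `(-1, 1)`. -/
def unitStep (x : ℝ) : ℝ := if |x| < 1 then 1 else 0

theorem measurable_unitStep : Measurable unitStep :=
  Measurable.ite (measurableSet_lt (by fun_prop) measurable_const) measurable_const measurable_const

theorem integrable_unitStep_sub_mul {ξ : ℝ} (hξ : ξ ≠ 0) (hξ1 : |ξ| < 1) :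
    Integrable fun u => (unitStep u - unitStep (u / ξ)) * |u|⁻¹ := by
  have h0 := abs_pos.2 hξ
  have hm := measurable_unitStep
  refine integrable_of_bounded_of_eq_zero (R := 1) (C := |ξ|⁻¹) (by fun_prop) (fun u => ?_)
    (fun u hu => ?_)
  · have : |u / ξ| < 1 ↔ |u| < |ξ| := by rw [abs_div, div_lt_one h0]
    simp only [unitStep, this]
    split_ifs with h1 h2 h2
    · simp
    · simpa using inv_anti₀ h0 (not_lt.1 h2)
    · linarith
    · simp
  · have : |u / ξ| < 1 ↔ |u| < |ξ| := by rw [abs_div, div_lt_one h0]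
    simp [unitStep, this, not_lt.2 hu.le, not_lt.2 (hξ1.trans hu).le]

theorem integral_unitStep_sub_mul {ξ : ℝ} (hξ : ξ ≠ 0) (hξ1 : |ξ| < 1) :
    ∫ u, (unitStep u - unitStep (u / ξ)) * |u|⁻¹ = -2 * Real.log |ξ| := by
  have h0 := abs_pos.2 hξ
  have : ∀ u : ℝ, (unitStep u - unitStep (u / ξ)) * |u|⁻¹ =
      (Set.Ico |ξ| 1).indicator (fun t => t⁻¹) |u| := by
    intro u
    have : |u / ξ| < 1 ↔ |u| < |ξ| := by rw [abs_div, div_lt_one h0]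
    simp only [unitStep, this, Set.indicator, Set.mem_Ico]
    split_ifs <;> first | simp; done | (exfalso; grind)
  simp_rw [this]
  rw [integral_comp_abs, setIntegral_indicator measurableSet_Ico,
    Set.inter_eq_self_of_subset_right (show Set.Ico |ξ| 1 ⊆ Set.Ioi 0 from fun t ht =>
      h0.trans_le ht.1), integral_Ico_eq_integral_Ioo,
    ← integral_Ioc_eq_integral_Ioo, ← intervalIntegral.integral_of_le hξ1.le,
    integral_inv_of_pos h0 one_pos, one_div, Real.log_inv]
  ring

theorem integrable_cutoff_sub_mul : Integrable fun u => (cutoff u - unitStep u) * |u|⁻¹ := by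
  have hm := measurable_unitStep
  have hc := cutoff.continuous.measurable
  refine integrable_of_bounded_of_eq_zero (R := 2) (C := 1) (by fun_prop) (fun u => ?_)
    (fun u hu => ?_)
  · rcases lt_or_ge |u| 1 with h | h
    · simp [unitStep, h, cutoff_eq_one h.le]
    · simp only [unitStep, not_lt.2 h, if_false, sub_zero, abs_mul, abs_inv, abs_abs,
        abs_of_nonneg cutoff.nonneg]
      exact mul_le_one₀ cutoff.le_one (by positivity) (inv_le_one_of_one_le₀ h)
  · simp [unitStep, cutoff_eq_zero hu.le, not_lt.2 (one_le_two.trans hu.le)]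

theorem integrable_unitStep_sub_cutoff_inv_mul :
    Integrable fun s => (unitStep s - (1 - cutoff s⁻¹)) * |s|⁻¹ := by
  have hm := measurable_unitStep
  have hc := cutoff.continuous.measurable
  refine integrable_of_bounded_of_eq_zero (R := 1) (C := 2) (by fun_prop) (fun s => ?_)
    (fun s hs => ?_)
  · rcases eq_or_ne s 0 with rfl | hs0
    · simp
    have hs0' := abs_pos.2 hs0
    rcases le_or_gt |s| (1 / 2) with h | h
    · have : cutoff s⁻¹ = 0 := cutoff_eq_zero (by
        rw [abs_inv, le_inv_comm₀ two_pos hs0']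
        linarith)
      simp [unitStep, this, h.trans_lt one_half_lt_one]
    · have h1 : |s|⁻¹ ≤ 2 := by
        rw [inv_le_comm₀ hs0' two_pos]
        linarith
      have h2 : |unitStep s - (1 - cutoff s⁻¹)| ≤ 1 := by
        have := cutoff.nonneg (x := s⁻¹)
        have := cutoff.le_one (x := s⁻¹)
        unfold unitStep
        split_ifs <;> rw [abs_le] <;> constructor <;> linarith
      rw [abs_mul, abs_inv, abs_abs]
      calc _ ≤ 1 * (2 : ℝ) := by gcongr
        _ = 2 := one_mul 2
  · have : cutoff s⁻¹ = 1 := cutoff_eq_one (by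
      rw [abs_inv]
      exact inv_le_one_of_one_le₀ hs.le)
    simp [unitStep, this, not_lt.2 hs.le]

/-- The orbital integral of the product of two cutoffs. -/
theorem exists_integral_cutoff_mul_eq :
    ∃ c : ℝ, ∀ ξ : ℝ, ξ ≠ 0 → |ξ| < 1 →
      ∫ u, cutoff u * cutoff (ξ / u) * |u|⁻¹ = c - 2 * Real.log |ξ| := by
  refine ⟨(∫ u, (cutoff u - unitStep u) * |u|⁻¹) +
    ∫ s, (unitStep s - (1 - cutoff s⁻¹)) * |s|⁻¹, fun ξ hξ hξ1 => ?_⟩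
  have h0 := abs_pos.2 hξ
  have hdecomp : ∀ u : ℝ, cutoff u * cutoff (ξ / u) * |u|⁻¹ =
      ((cutoff u - unitStep u) * |u|⁻¹ + (unitStep u - unitStep (u / ξ)) * |u|⁻¹) +
      |ξ|⁻¹ * ((unitStep (u / ξ) - (1 - cutoff (u / ξ)⁻¹)) * |u / ξ|⁻¹) := by
    intro u
    have h1 : cutoff u * cutoff (ξ / u) = cutoff u + cutoff (ξ / u) - 1 := by
      rcases le_total |u| 1 with h | h
      · rw [cutoff_eq_one h]
        ring
      · rw [cutoff_eq_one (x := ξ / u) (by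
          rw [abs_div]
          exact div_le_one_of_le₀ (hξ1.le.trans h) (abs_nonneg u))]
        ring
    rw [h1, inv_div, abs_div, inv_div]
    field_simp
    ring
  have hQ := integrable_unitStep_sub_cutoff_inv_mul
  have hP : Integrable fun u => (cutoff u - unitStep u) * |u|⁻¹ +
      (unitStep u - unitStep (u / ξ)) * |u|⁻¹ :=
    integrable_cutoff_sub_mul.add (integrable_unitStep_sub_mul hξ hξ1)
  simp_rw [hdecomp]
  rw [integral_add hP ((hQ.comp_div hξ).const_mul _),
    integral_add integrable_cutoff_sub_mul (integrable_unitStep_sub_mul hξ hξ1),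
    integral_unitStep_sub_mul hξ hξ1, integral_const_mul,
    Measure.integral_comp_div (fun s => (unitStep s - (1 - cutoff s⁻¹)) * |s|⁻¹) ξ, smul_eq_mul,
    inv_mul_cancel_left₀ h0.ne']
  ring

theorem partialX_sub (Φ Ψ : 𝓢(ℝ × ℝ, ℂ)) : partialX (Φ - Ψ) = partialX Φ - partialX Ψ := by
  simp only [partialX, sub_eq_add_neg, LineDeriv.lineDerivOp_add, LineDeriv.lineDerivOp_neg]

theorem partialY_sub (Φ Ψ : 𝓢(ℝ × ℝ, ℂ)) : partialY (Φ - Ψ) = partialY Φ - partialY Ψ := by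
  simp only [partialY, sub_eq_add_neg, LineDeriv.lineDerivOp_add, LineDeriv.lineDerivOp_neg]

theorem partialX_iterate_sub (Φ Ψ : 𝓢(ℝ × ℝ, ℂ)) (k : ℕ) :
    partialX^[k] (Φ - Ψ) = partialX^[k] Φ - partialX^[k] Ψ := by
  induction k with
  | zero => rfl
  | succ k ih => simp only [Function.iterate_succ_apply', ih, partialX_sub]

theorem partialY_iterate_sub (Φ Ψ : 𝓢(ℝ × ℝ, ℂ)) (k : ℕ) :
    partialY^[k] (Φ - Ψ) = partialY^[k] Φ - partialY^[k] Ψ := by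
  induction k with
  | zero => rfl
  | succ k ih => simp only [Function.iterate_succ_apply', ih, partialY_sub]

/-- A compactly supported function agreeing with `f (x * y)` near the origin. -/
def cutProductFun (f : ℝ → ℂ) (p : ℝ × ℝ) : ℂ := ((cutoff p.1 * cutoff p.2 : ℝ) : ℂ) * f (p.1 * p.2)

theorem hasCompactSupport_cutProductFun (f : ℝ → ℂ) : HasCompactSupport (cutProductFun f) := by
  refine HasCompactSupport.intro (isCompact_closedBall (0 : ℝ × ℝ) 2) fun p hp => ?_
  have : 2 < |p.1| ∨ 2 < |p.2| := by
    rw [mem_closedBall_zero_iff, not_le] at hp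
    exact lt_max_iff.1 hp
  rcases this with h | h <;> simp [cutProductFun, cutoff_eq_zero h.le]

theorem contDiff_cutProductFun {f : ℝ → ℂ} (hf : ContDiff ℝ ∞ f) :
    ContDiff ℝ ∞ (cutProductFun f) :=
  (Complex.ofRealCLM.contDiff.comp
    ((cutoff.contDiff.comp contDiff_fst).mul (cutoff.contDiff.comp contDiff_snd))).mul
    (hf.comp (contDiff_fst.mul contDiff_snd))

/-- The Schwartz function underlying `cutProductFun`. -/
def cutProduct {f : ℝ → ℂ} (hf : ContDiff ℝ ∞ f) : 𝓢(ℝ × ℝ, ℂ) :=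
  (hasCompactSupport_cutProductFun f).toSchwartzMap (contDiff_cutProductFun hf)

theorem cutProduct_apply {f : ℝ → ℂ} (hf : ContDiff ℝ ∞ f) (x y : ℝ) :
    cutProduct hf (x, y) = ((cutoff x * cutoff y : ℝ) : ℂ) * f (x * y) := rfl

theorem partialX_iterate_cutProduct {f : ℝ → ℂ} (hf : ContDiff ℝ ∞ f) (k : ℕ) {y : ℝ}
    (hy : |y| ≤ 1) :
    (partialX^[k] (cutProduct hf)) (0, y) = y ^ k • iteratedDeriv k f 0 := by
  have h : (fun x => cutProduct hf (x, y)) =ᶠ[𝓝 0] fun x => f (y * x) := by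
    filter_upwards [cutoff.eventuallyEq_one] with x hx
    simp [cutProduct_apply, hx, cutoff_eq_one hy, mul_comm]
  rw [← congrFun (iteratedDeriv_fst (cutProduct hf) k y) 0, h.iteratedDeriv_eq,
    iteratedDeriv_comp_const_smul (hf.of_le (by exact_mod_cast le_top))]
  simp

theorem partialY_iterate_partialX_iterate_cutProduct {f : ℝ → ℂ} (hf : ContDiff ℝ ∞ f) (k : ℕ) :
    (partialY^[k] (partialX^[k] (cutProduct hf))) (0, 0) = k.factorial * iteratedDeriv k f 0 := by
  have h : (fun y => (partialX^[k] (cutProduct hf)) (0, y)) =ᶠ[𝓝 0]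
      fun y => y ^ k • iteratedDeriv k f 0 := by
    filter_upwards [Metric.ball_mem_nhds (0 : ℝ) one_pos] with y hy
    exact partialX_iterate_cutProduct hf k (by simpa using (mem_ball_zero_iff.1 hy).le)
  rw [← congrFun (iteratedDeriv_snd (partialX^[k] (cutProduct hf)) k 0) 0, h.iteratedDeriv_eq,
    iteratedDeriv_smul_const (by fun_prop), iteratedDeriv_fun_pow_zero]
  simp

theorem orbital_cutProduct {f : ℝ → ℂ} (hf : ContDiff ℝ ∞ f) (ξ : ℝ) :
    orbital (cutProduct hf) ξ = f ξ * ((∫ u, cutoff u * cutoff (ξ / u) * |u|⁻¹ : ℝ) : ℂ) := by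
  rw [orbital, ← integral_complex_ofReal, ← integral_const_mul]
  refine integral_congr_ae ?_
  filter_upwards [Measure.ae_ne volume (0 : ℝ)] with u hu
  rw [orbitalIntegrand, cutProduct_apply, mul_div_cancel₀ _ hu]
  push_cast
  ring

theorem orbital_sub (Φ Ψ : 𝓢(ℝ × ℝ, ℂ)) {ξ : ℝ} (hξ : ξ ≠ 0) :
    orbital (Φ - Ψ) ξ = orbital Φ ξ - orbital Ψ ξ := by
  rw [orbital, orbital, orbital,
    ← integral_sub (integrable_orbitalIntegrand Φ hξ) (integrable_orbitalIntegrand Ψ hξ)]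
  exact integral_congr_ae (.of_forall fun u => by simp [orbitalIntegrand, sub_mul])

theorem exists_orbital_expansion (Φ : 𝓢(ℝ × ℝ, ℂ)) :
    ∃ C₁ C₂ : ℝ → ℂ, ContDiff ℝ ∞ C₁ ∧ ContDiff ℝ ∞ C₂ ∧
      (∀ ξ : ℝ, ξ ≠ 0 → |ξ| < 1 → orbital Φ ξ = C₁ ξ + C₂ ξ * (Real.log |ξ| : ℂ)) ∧
      C₂ 0 = -2 * Φ (0, 0) := by
  obtain ⟨f, hf, hf0⟩ := exists_contDiff_iteratedDeriv_zero_eq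
    fun k => (partialY^[k] (partialX^[k] Φ)) (0, 0) / k.factorial
  obtain ⟨c, hc⟩ := exists_integral_cutoff_mul_eq
  obtain ⟨F, hF, hFeq⟩ := exists_contDiff_eq_orbital (Φ - cutProduct hf) fun k => by
    have : (k.factorial : ℂ) ≠ 0 := by exact_mod_cast k.factorial_ne_zero
    rw [partialX_iterate_sub, partialY_iterate_sub, sub_apply,
      partialY_iterate_partialX_iterate_cutProduct, hf0, mul_div_cancel₀ _ this, sub_self]
  refine ⟨fun ξ => F ξ + c * f ξ, fun ξ => -2 * f ξ, hF.add (contDiff_const.mul hf),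
    contDiff_const.mul hf, fun ξ hξ hξ1 => ?_, ?_⟩
  · have h := hFeq ξ hξ
    rw [orbital_sub _ _ hξ, orbital_cutProduct, hc ξ hξ hξ1, sub_eq_iff_eq_add] at h
    rw [h]
    push_cast
    ring
  · have h := hf0 0
    simp only [iteratedDeriv_zero, Function.iterate_zero, id, Nat.factorial_zero, Nat.cast_one,
      div_one] at h
    simp only [h]

end SplitOrbital

end

/-- Germ expansion of split orbital integrals of a Schwartz function on `ℝ²` near `ξ = 0`:
`O_ξ(Φ)` converges for `ξ ≠ 0` and equals `C₁(ξ) + C₂(ξ)·log|ξ|` near `0` with `C₁, C₂` smooth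
and `C₂(0) = -2Φ(0,0)`. -/
theorem stmt_6 (Φ : SchwartzMap (ℝ × ℝ) ℂ) :
    (∀ ξ : ℝ, ξ ≠ 0 →
      Integrable (fun u : ℝ => Φ (u, ξ / u) * ((|u| : ℝ) : ℂ)⁻¹)) ∧
    ∃ ε : ℝ, 0 < ε ∧ ∃ C₁ C₂ : ℝ → ℂ, ContDiff ℝ (⊤ : ℕ∞) C₁ ∧ ContDiff ℝ (⊤ : ℕ∞) C₂ ∧
      (∀ ξ : ℝ, ξ ≠ 0 → |ξ| < ε →
        (∫ u : ℝ, Φ (u, ξ / u) * ((|u| : ℝ) : ℂ)⁻¹) =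
          C₁ ξ + C₂ ξ * (Real.log |ξ| : ℂ)) ∧
      C₂ 0 = -2 * Φ (0, 0) := by
  obtain ⟨C₁, C₂, hC₁, hC₂, hC, h0⟩ := SplitOrbital.exists_orbital_expansion Φ
  exact ⟨fun ξ hξ => SplitOrbital.integrable_orbitalIntegrand Φ hξ, 1, one_pos, C₁, C₂, hC₁, hC₂,
    hC, h0⟩
end

section
/- Let Φ : ℝ² → ℂ be a Schwartz function. Then there exists a smooth function C : ℝ → ℂ such that for every ξ > 0, C(ξ) = ∫_0^{2π} Φ(√ξ·cos θ, √ξ·sin θ) dθ; in particular C(0) = 2π·Φ(0,0). (That is, the SO(2)-orbital integral of Φ, viewed as a function of the invariant ξ = x² + y², extends smoothly across ξ = 0.) -/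
open MeasureTheory

/-- The function `cos √z` is entire. -/
lemma exists_entire_comp_sq_eq_cos :
    ∃ E : ℂ → ℂ, Differentiable ℂ E ∧ ∀ w, E (w ^ 2) = Complex.cos w := by
  let s : ℂ → ℂ := fun z ↦ z ^ (((2 : ℕ) : ℂ)⁻¹)
  have hs (z : ℂ) : s z ^ 2 = z := Complex.cpow_nat_inv_pow z two_ne_zero
  have hE (w : ℂ) : Complex.cos (s (w ^ 2)) = Complex.cos w := by
    rcases sq_eq_sq_iff_eq_or_eq_neg.1 (hs (w ^ 2)) with h | h <;> simp [h]
  have hd {z : ℂ} (hz : z ∈ Complex.slitPlane) : DifferentiableAt ℂ s z :=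
    differentiableAt_id.cpow_const hz
  refine ⟨fun z ↦ Complex.cos (s z), ?_, hE⟩
  rw [← differentiableOn_univ,
    ← Complex.differentiableOn_compl_singleton_and_continuousAt_iff (c := 0) Filter.univ_mem]
  constructor
  · rintro z ⟨-, hz⟩
    have hz : z ≠ 0 := hz
    refine DifferentiableAt.differentiableWithinAt ?_
    by_cases h : z ∈ Complex.slitPlane
    · exact (hd h).ccos
    · have hn : -z ∈ Complex.slitPlane := by
        simp only [Complex.mem_slitPlane_iff, not_or, not_lt, ne_eq, not_not] at h
        rw [Complex.mem_slitPlane_iff]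
        left
        rw [Complex.neg_re, neg_pos]
        exact h.1.lt_of_ne fun h0 ↦ hz (Complex.ext h0 h.2)
      have heq : (fun y ↦ Complex.cos (s y)) = fun y ↦ Complex.cos (Complex.I * s (-y)) := by
        funext y
        rw [← hE (Complex.I * s (-y)), mul_pow, hs, Complex.I_sq, neg_mul_neg, one_mul]
      rw [heq]
      exact (((hd hn).comp z differentiableAt_id.neg).const_mul Complex.I).ccos
  · exact Complex.continuous_cos.continuousAt.comp
      (Complex.continuousAt_cpow_const_of_re_pos (Or.inl le_rfl) (by norm_num))

lemma Complex.norm_cos_le_exp_abs_im (w : ℂ) : ‖Complex.cos w‖ ≤ Real.exp |w.im| := by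
  have h1 : ‖Complex.exp (w * Complex.I)‖ ≤ Real.exp |w.im| := by
    rw [Complex.norm_exp]
    simpa using neg_le_abs w.im
  have h2 : ‖Complex.exp (-w * Complex.I)‖ ≤ Real.exp |w.im| := by
    rw [Complex.norm_exp]
    simpa using le_abs_self w.im
  rw [Complex.cos, norm_div, Complex.norm_two, div_le_iff₀ two_pos]
  exact (norm_add_le _ _).trans (by linarith)

lemma Complex.abs_im_le_one_of_norm_sq_sub_le {w : ℂ} {u : ℝ} (hu : 0 ≤ u)
    (h : ‖w ^ 2 - u‖ ≤ 1) : |w.im| ≤ 1 := by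
  have h1 : ‖w ^ 2‖ ≤ 1 + u := by
    have := norm_add_le (w ^ 2 - u) (u : ℂ)
    rw [sub_add_cancel, Complex.norm_of_nonneg hu] at this
    linarith
  have h2 := (abs_le.1 ((Complex.abs_re_le_norm _).trans h)).1
  rw [norm_pow, Complex.sq_norm, Complex.normSq_apply] at h1
  simp only [pow_two, Complex.sub_re, Complex.mul_re, Complex.ofReal_re] at h2
  rw [← sq_le_one_iff_abs_le_one]
  nlinarith

lemma iteratedDeriv_comp_ofReal {f : ℂ → ℂ} (hf : Differentiable ℂ f) (k : ℕ) :
    iteratedDeriv k (fun x : ℝ ↦ f x) = fun x : ℝ ↦ iteratedDeriv k f x := by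
  induction k with
  | zero => simp
  | succ k ih =>
    funext x
    rw [iteratedDeriv_succ, ih, iteratedDeriv_succ]
    exact ((hf.contDiff (n := ⊤)).differentiable_iteratedDeriv k
      (WithTop.coe_lt_top _) x).hasDerivAt.comp_ofReal.deriv

/-- There is a smooth function on the line, all of whose derivatives are bounded, which agrees
with `cos √u` for `u ≥ 0`. -/
lemma exists_contDiff_bounded_comp_sq_eq_cos :
    ∃ c : ℝ → ℂ, ContDiff ℝ (⊤ : ℕ∞) c ∧ (∀ k, ∃ M, ∀ x, ‖iteratedDeriv k c x‖ ≤ M) ∧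
      ∀ r : ℝ, c (r ^ 2) = Complex.cos r := by
  obtain ⟨E, hE, hcos⟩ := exists_entire_comp_sq_eq_cos
  have hEs : ContDiff ℝ (⊤ : ℕ∞) fun x : ℝ ↦ E x :=
    ((hE.contDiff (n := (⊤ : ℕ∞))).restrict_scalars ℝ).comp Complex.ofRealCLM.contDiff
  have hbound (k : ℕ) (u : ℝ) (hu : 0 ≤ u) :
      ‖iteratedDeriv k (fun x : ℝ ↦ E x) u‖ ≤ k.factorial * Real.exp 1 / 1 ^ k := by
    rw [iteratedDeriv_comp_ofReal hE]
    refine Complex.norm_iteratedDeriv_le_of_forall_mem_sphere_norm_le k one_pos hE.diffContOnCl ?_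
    intro z hz
    obtain ⟨w, rfl⟩ : ∃ w : ℂ, z = w ^ 2 := ⟨_, (Complex.cpow_nat_inv_pow z two_ne_zero).symm⟩
    rw [hcos]
    refine (Complex.norm_cos_le_exp_abs_im w).trans (Real.exp_le_exp.2 ?_)
    exact Complex.abs_im_le_one_of_norm_sq_sub_le hu (mem_sphere_iff_norm.1 hz).le
  let c : ℝ → ℂ := fun u ↦ Real.smoothTransition (u + 1) * E u
  have hc : ContDiff ℝ (⊤ : ℕ∞) c :=
    (Complex.ofRealCLM.contDiff.comp
      (Real.smoothTransition.contDiff.comp (contDiff_id.add contDiff_const))).mul hEs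
  refine ⟨c, hc, fun k ↦ ?_, fun r ↦ ?_⟩
  · obtain ⟨M, hM⟩ := (isCompact_Icc (a := (-1 : ℝ)) (b := 0)).exists_bound_of_continuousOn
      (hc.continuous_iteratedDeriv k (by exact_mod_cast le_top)).continuousOn
    refine ⟨max M (k.factorial * Real.exp 1 / 1 ^ k), fun x ↦ ?_⟩
    rcases lt_or_ge x (-1) with h | h
    · have : c =ᶠ[nhds x] fun _ ↦ 0 := by
        filter_upwards [Iio_mem_nhds h] with y hy
        have hy : y < -1 := hy
        simp [c, Real.smoothTransition.zero_of_nonpos (show y + 1 ≤ 0 by linarith)]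
      rw [this.iteratedDeriv_eq]
      refine le_max_of_le_right ?_
      simp only [iteratedDeriv_const, ite_self, norm_zero]
      positivity
    rcases le_or_gt x 0 with h' | h'
    · exact le_max_of_le_left (hM x ⟨h, h'⟩)
    · have : c =ᶠ[nhds x] fun u : ℝ ↦ E u := by
        filter_upwards [Ioi_mem_nhds h'] with y hy
        have hy : 0 < y := hy
        simp [c, Real.smoothTransition.one_of_one_le (show 1 ≤ y + 1 by linarith)]
      rw [this.iteratedDeriv_eq]
      exact le_max_of_le_right (hbound k x h'.le)
  · have : 1 ≤ r ^ 2 + 1 := by nlinarith [sq_nonneg r]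
    simp [c, Real.smoothTransition.one_of_one_le this, hcos]

/-- Differentiation under the integral sign to all orders. -/
lemma contDiff_integral_comp_mul {α : Type*} [MeasurableSpace α] {μ : Measure α}
    {c : ℝ → ℂ} (hc : ContDiff ℝ (⊤ : ℕ∞) c) (hb : ∀ k, ∃ M, ∀ x, ‖iteratedDeriv k c x‖ ≤ M)
    {a : α → ℝ} (ha : AEStronglyMeasurable a μ) {F : α → ℂ}
    (hF : ∀ k : ℕ, Integrable (fun x ↦ (a x : ℂ) ^ k * F x) μ) :
    ContDiff ℝ (⊤ : ℕ∞) fun ξ : ℝ ↦ ∫ x, c (a x * ξ) * F x ∂μ := by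
  let G (k : ℕ) (ξ : ℝ) (x : α) : ℂ := iteratedDeriv k c (a x * ξ) * ((a x : ℂ) ^ k * F x)
  have hmeas (k : ℕ) (ξ : ℝ) :
      AEStronglyMeasurable (fun x ↦ iteratedDeriv k c (a x * ξ)) μ :=
    (hc.continuous_iteratedDeriv k (by exact_mod_cast le_top)).comp_aestronglyMeasurable
      (ha.mul_const ξ)
  have hint (k : ℕ) (ξ : ℝ) : Integrable (G k ξ) μ := by
    obtain ⟨M, hM⟩ := hb k
    exact (hF k).bdd_mul (hmeas k ξ) (Filter.Eventually.of_forall fun x ↦ hM _)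
  have hderiv (k : ℕ) (ξ : ℝ) :
      HasDerivAt (fun ξ ↦ ∫ x, G k ξ x ∂μ) (∫ x, G (k + 1) ξ x ∂μ) ξ := by
    obtain ⟨M, hM⟩ := hb (k + 1)
    refine (hasDerivAt_integral_of_dominated_loc_of_deriv_le (s := Set.univ)
      (bound := fun x ↦ M * ‖(a x : ℂ) ^ (k + 1) * F x‖) Filter.univ_mem
      (Filter.Eventually.of_forall fun ξ ↦ (hint k ξ).1) (hint k ξ) (hint (k + 1) ξ).1
      (Filter.Eventually.of_forall fun x ξ _ ↦ ?_) ((hF (k + 1)).norm.const_mul M)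
      (Filter.Eventually.of_forall fun x ξ _ ↦ ?_)).2
    · rw [norm_mul]
      gcongr
      exact hM _
    · have h1 : HasDerivAt (iteratedDeriv k c) (iteratedDeriv (k + 1) c (a x * ξ)) (a x * ξ) := by
        rw [iteratedDeriv_succ]
        exact (hc.differentiable_iteratedDeriv k (by exact_mod_cast WithTop.coe_lt_top k)
          _).hasDerivAt
      have h2 := (h1.scomp ξ ((hasDerivAt_id ξ).const_mul (a x))).mul_const
        ((a x : ℂ) ^ k * F x)
      refine h2.congr_deriv ?_
      simp only [G, mul_one, Complex.real_smul]
      ring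
  have key (n : ℕ) : ∀ k, ContDiff ℝ n fun ξ ↦ ∫ x, G k ξ x ∂μ := by
    induction n with
    | zero =>
      exact fun k ↦ contDiff_zero.2
        (continuous_iff_continuousAt.2 fun ξ ↦ (hderiv k ξ).continuousAt)
    | succ n ih =>
      intro k
      rw [Nat.cast_succ]
      refine contDiff_succ_iff_deriv.2
        ⟨fun ξ ↦ (hderiv k ξ).differentiableAt, fun h ↦ absurd h (WithTop.coe_ne_top), ?_⟩
      rw [funext fun ξ ↦ (hderiv k ξ).deriv]
      exact ih (k + 1)
  simpa [G] using contDiff_infty.2 fun n ↦ key n 0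

lemma SchwartzMap.integral_cos_mul_fourier {V : Type*} [NormedAddCommGroup V]
    [InnerProductSpace ℝ V] [FiniteDimensional ℝ V] [MeasurableSpace V] [BorelSpace V]
    (f : SchwartzMap V ℂ) (x : V) :
    ∫ w, Complex.cos (2 * Real.pi * inner ℝ w x : ℝ) * FourierTransform.fourier f w =
      (f x + f (-x)) / 2 := by
  have hinv (y : V) :
      f y = ∫ w, Complex.exp (↑(2 * Real.pi * inner ℝ w y) * Complex.I) •
        FourierTransform.fourier f w := by
    rw [← Real.fourierInv_eq', ← SchwartzMap.fourierInv_coe, FourierPair.fourierInv_fourier_eq]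
  have hint (y : V) : Integrable fun w ↦
      Complex.exp (↑(2 * Real.pi * inner ℝ w y) * Complex.I) • FourierTransform.fourier f w := by
    refine (FourierTransform.fourier f).integrable.bdd_mul (c := 1) ?_ ?_
    · exact Continuous.aestronglyMeasurable (by fun_prop)
    · exact Filter.Eventually.of_forall fun w ↦ (Complex.norm_exp_ofReal_mul_I _).le
  rw [hinv x, hinv (-x), ← integral_add (hint x) (hint (-x)), ← integral_div]
  refine integral_congr_ae (Filter.Eventually.of_forall fun w ↦ ?_)
  simp only [Complex.cos, inner_neg_right, smul_eq_mul]
  push_cast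
  ring_nf

/-- The `SO(2)`-orbital integral of a Schwartz function on `ℝ²`, viewed as a function of the
invariant `ξ = x² + y²`, extends smoothly across `ξ = 0`, with value `2π·Φ(0,0)` there. -/
theorem stmt_7 (Φ : SchwartzMap (ℝ × ℝ) ℂ) :
    ∃ C : ℝ → ℂ, ContDiff ℝ (⊤ : ℕ∞) C ∧
      (∀ ξ : ℝ, 0 < ξ →
        C ξ = ∫ θ in (0 : ℝ)..(2 * Real.pi),
          Φ (Real.sqrt ξ * Real.cos θ, Real.sqrt ξ * Real.sin θ)) ∧
      C 0 = 2 * Real.pi * Φ (0, 0) := by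
  obtain ⟨c, hc, hb, hcos⟩ := exists_contDiff_bounded_comp_sq_eq_cos
  let Ψ : SchwartzMap ℂ ℂ :=
    SchwartzMap.compCLMOfContinuousLinearEquiv ℂ Complex.equivRealProdCLM Φ
  have hΨ (z : ℂ) : Ψ z = Φ (z.re, z.im) := rfl
  let g := FourierTransform.fourier Ψ
  let e (θ : ℝ) : ℂ := ⟨Real.cos θ, Real.sin θ⟩
  have he : Continuous e := by
    have : e = fun θ : ℝ ↦ (Real.cos θ : ℂ) + Real.sin θ * Complex.I :=
      funext fun θ ↦ Complex.mk_eq_add_mul_I _ _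
    rw [this]
    fun_prop
  have hen (θ : ℝ) : ‖e θ‖ = 1 := by
    rw [Complex.norm_def, Complex.normSq_mk, ← pow_two, ← pow_two, Real.cos_sq_add_sin_sq,
      Real.sqrt_one]
  let a (p : ℝ × ℂ) : ℝ := (2 * Real.pi * inner ℝ p.2 (e p.1)) ^ 2
  have hac : Continuous a := by fun_prop
  have ha_le (p : ℝ × ℂ) : |a p| ≤ (2 * Real.pi) ^ 2 * ‖p.2‖ ^ 2 := by
    have h := abs_real_inner_le_norm p.2 (e p.1)
    rw [hen, mul_one] at h
    simp only [a]
    rw [abs_of_nonneg (sq_nonneg _), mul_pow (2 * Real.pi) (inner ℝ p.2 (e p.1)), ← sq_abs (inner ℝ p.2 (e p.1))]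
    gcongr
  let ν : Measure ℝ := volume.restrict (Set.Ioc 0 (2 * Real.pi))
  have hF (k : ℕ) : Integrable (fun p ↦ (a p : ℂ) ^ k * g p.2) (ν.prod volume) := by
    have h := (integrable_const (1 : ℝ) (μ := ν)).mul_prod
      ((g.integrable_pow_mul volume (2 * k)).const_mul ((2 * Real.pi) ^ (2 * k)))
    refine h.mono' (Continuous.aestronglyMeasurable ?_) (Filter.Eventually.of_forall fun p ↦ ?_)
    · have := g.continuous
      fun_prop
    · rw [norm_mul, norm_pow, Complex.norm_real, Real.norm_eq_abs, one_mul, ← mul_assoc]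
      gcongr
      refine (pow_le_pow_left₀ (abs_nonneg _) (ha_le p) k).trans_eq ?_
      rw [mul_pow, ← pow_mul, ← pow_mul]
  have hmain (ξ : ℝ) (hξ : 0 ≤ ξ) :
      ∫ p, c (a p * ξ) * g p.2 ∂(ν.prod volume) =
        ∫ θ in (0 : ℝ)..(2 * Real.pi), Ψ (Real.sqrt ξ • e θ) := by
    have hint : Integrable (fun p ↦ c (a p * ξ) * g p.2) (ν.prod volume) := by
      obtain ⟨M, hM⟩ := hb 0
      have h0 := hF 0
      simp only [pow_zero, one_mul] at h0
      refine h0.bdd_mul (c := M) ?_ (Filter.Eventually.of_forall fun p ↦ by simpa using hM _)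
      exact (hc.continuous.comp (hac.mul continuous_const)).aestronglyMeasurable
    have hinner (θ : ℝ) : ∫ w, c (a (θ, w) * ξ) * g w =
        (Ψ (Real.sqrt ξ • e θ) + Ψ (-(Real.sqrt ξ • e θ))) / 2 := by
      rw [← SchwartzMap.integral_cos_mul_fourier]
      refine integral_congr_ae (Filter.Eventually.of_forall fun w ↦ ?_)
      simp only
      rw [← hcos, real_inner_smul_right]
      congr 2
      simp only [a]
      rw [mul_left_comm, mul_pow (Real.sqrt ξ), Real.sq_sqrt hξ, mul_comm ξ]
    have hse : Continuous fun θ ↦ Real.sqrt ξ • e θ := by fun_prop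
    have hcont : Continuous fun θ ↦ Ψ (Real.sqrt ξ • e θ) := Ψ.continuous.comp hse
    have heπ (θ : ℝ) : -(Real.sqrt ξ • e θ) = Real.sqrt ξ • e (θ + Real.pi) := by
      rw [← smul_neg]
      congr 1
      simp [e, Complex.ext_iff]
    have hper : Function.Periodic (fun θ ↦ Ψ (Real.sqrt ξ • e θ)) (2 * Real.pi) := fun θ ↦ by
      simp [e]
    have hneg : ∫ θ in (0 : ℝ)..(2 * Real.pi), Ψ (-(Real.sqrt ξ • e θ)) =
        ∫ θ in (0 : ℝ)..(2 * Real.pi), Ψ (Real.sqrt ξ • e θ) := by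
      simp only [heπ]
      rw [intervalIntegral.integral_comp_add_right (fun θ ↦ Ψ (Real.sqrt ξ • e θ)),
        add_comm (2 * Real.pi), zero_add, hper.intervalIntegral_add_eq Real.pi 0, zero_add]
    rw [integral_prod _ hint]
    simp only [hinner]
    rw [← intervalIntegral.integral_of_le Real.two_pi_pos.le, intervalIntegral.integral_div,
      intervalIntegral.integral_add (hcont.intervalIntegrable _ _), hneg, add_self_div_two]
    exact (Ψ.continuous.comp hse.neg).intervalIntegrable _ _
  refine ⟨fun ξ ↦ ∫ p, c (a p * ξ) * g p.2 ∂(ν.prod volume),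
    contDiff_integral_comp_mul hc hb hac.aestronglyMeasurable hF, fun ξ hξ ↦ ?_, ?_⟩
  · simp [hmain ξ hξ.le, hΨ, e]
  · refine (hmain 0 le_rfl).trans ?_
    simp [hΨ]
end

section
/- Let Φ : ℝ² → ℂ be a Schwartz function. Then for every complex number s with Re(s) > 0 the integral Z(s) = ∫_{ℝ²} Φ(x,y)·|x·y|^{s−1} dx dy converges absolutely, and there exists an entire function G : ℂ → ℂ with G(0) = Φ(0,0) such that Z(s) = Γ(s/2)²·G(s) for all s with Re(s) > 0. In particular Z extends meromorphically to ℂ with at most double poles, located at s = 0, −2, −4, …, and lim_{δ→0⁺} δ²·Z(δ) = 4·Φ(0,0). -/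
open MeasureTheory

theorem ae_coord_ne_zero : ∀ᵐ q : ℝ × ℝ, q.1 ≠ 0 ∧ q.2 ≠ 0 := by
  have h0 : ∀ᵐ x : ℝ, x ≠ 0 := Measure.ae_ne volume 0
  exact (Measure.quasiMeasurePreserving_fst.ae h0).and (Measure.quasiMeasurePreserving_snd.ae h0)

theorem integrable_abs_rpow_mul_one_add_abs_pow_inv {σ : ℝ} (hσ : 0 < σ) {N : ℕ} (hN : σ < N) :
    Integrable (fun x : ℝ => |x| ^ (σ - 1) * ((1 + |x|) ^ N)⁻¹) := by
  have hm : Measurable fun x : ℝ => x ^ (σ - 1) * ((1 + x) ^ N)⁻¹ := by fun_prop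
  have h1 : IntegrableOn (fun x : ℝ => x ^ (σ - 1) * ((1 + x) ^ N)⁻¹) (Set.Ioi 0) := by
    rw [← Set.Ioc_union_Ioi_eq_Ioi zero_le_one]
    refine IntegrableOn.union ?_ ?_
    · have h : IntegrableOn (fun x : ℝ => x ^ (σ - 1)) (Set.Ioc 0 1) :=
        (intervalIntegral.intervalIntegrable_rpow' (by linarith)).1
      refine Integrable.mono' h hm.aestronglyMeasurable ?_
      refine (ae_restrict_iff' measurableSet_Ioc).2 (.of_forall fun x hx => ?_)
      have hx0 : 0 ≤ x := hx.1.le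
      rw [Real.norm_of_nonneg (by positivity)]
      exact mul_le_of_le_one_right (by positivity)
        (inv_le_one_of_one_le₀ (one_le_pow₀ (by linarith)))
    · have h : IntegrableOn (fun x : ℝ => x ^ (σ - 1 - N)) (Set.Ioi 1) :=
        integrableOn_Ioi_rpow_of_lt (by linarith) one_pos
      refine Integrable.mono' h hm.aestronglyMeasurable ?_
      refine (ae_restrict_iff' measurableSet_Ioi).2 (.of_forall fun x hx => ?_)
      have hx0 : 0 < x := one_pos.trans hx
      rw [Real.norm_of_nonneg (by positivity), Real.rpow_sub hx0 _ (N : ℝ), Real.rpow_natCast,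
        div_eq_mul_inv]
      gcongr
      linarith
  have h2 : IntegrableOn (fun x : ℝ => |x| ^ (σ - 1) * ((1 + |x|) ^ N)⁻¹) (Set.Ioi 0) :=
    h1.congr_fun (fun x hx => by simp only [abs_of_pos (Set.mem_Ioi.1 hx)]) measurableSet_Ioi
  rw [← integrableOn_univ, ← Set.Iic_union_Ioi (a := (0 : ℝ))]
  refine IntegrableOn.union ?_ h2
  rw [← integrableOn_Ici_iff_integrableOn_Ioi] at h2
  have h3 := (Measure.measurePreserving_neg (volume : Measure ℝ)).integrableOn_comp_preimage
    (Homeomorph.neg ℝ).measurableEmbedding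
    (f := fun x : ℝ => |x| ^ (σ - 1) * ((1 + |x|) ^ N)⁻¹) (s := Set.Ici 0)
  simpa [Function.comp_def] using h3.2 h2

theorem SchwartzMap.integrable_norm_mul_abs_mul_rpow (Φ : SchwartzMap (ℝ × ℝ) ℂ) {σ : ℝ}
    (hσ : 0 < σ) : Integrable (fun q : ℝ × ℝ => ‖Φ q‖ * |q.1 * q.2| ^ (σ - 1)) := by
  obtain ⟨N, hN⟩ := exists_nat_gt σ
  have h1 := integrable_abs_rpow_mul_one_add_abs_pow_inv hσ hN
  set C := 2 ^ (N + N) * (Finset.Iic (N + N, 0)).sup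
    (fun m => SchwartzMap.seminorm ℝ m.1 m.2) Φ
  refine Integrable.mono' ((h1.mul_prod h1).const_mul C) ?_ (.of_forall fun q => ?_)
  · exact (Φ.continuous.measurable.norm.mul (by fun_prop)).aestronglyMeasurable
  have hb := SchwartzMap.one_add_le_sup_seminorm_apply (𝕜 := ℝ) (m := (N + N, 0)) (le_refl _)
    (le_refl _) Φ q
  rw [norm_iteratedFDeriv_zero] at hb
  have hx : |q.1| ≤ ‖q‖ := norm_fst_le q
  have hy : |q.2| ≤ ‖q‖ := norm_snd_le q
  have h2 : (1 + |q.1|) ^ N * (1 + |q.2|) ^ N * ‖Φ q‖ ≤ C := by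
    refine le_trans ?_ hb
    rw [pow_add]
    gcongr
  rw [Real.norm_of_nonneg (by positivity), abs_mul, Real.mul_rpow (abs_nonneg _) (abs_nonneg _)]
  have h3 : ‖Φ q‖ ≤ C * (((1 + |q.1|) ^ N)⁻¹ * ((1 + |q.2|) ^ N)⁻¹) := by
    rw [← mul_inv, ← div_eq_mul_inv, le_div_iff₀ (by positivity)]
    linarith
  calc ‖Φ q‖ * (|q.1| ^ (σ - 1) * |q.2| ^ (σ - 1))
      ≤ C * (((1 + |q.1|) ^ N)⁻¹ * ((1 + |q.2|) ^ N)⁻¹) *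
        (|q.1| ^ (σ - 1) * |q.2| ^ (σ - 1)) := by gcongr
    _ = _ := by ring

theorem measurable_abs_mul_cpow (s : ℂ) :
    Measurable fun q : ℝ × ℝ => ((|q.1 * q.2| : ℝ) : ℂ) ^ s := by fun_prop

theorem SchwartzMap.integrable_mul_abs_mul_cpow (Φ : SchwartzMap (ℝ × ℝ) ℂ) {s : ℂ}
    (hs : 0 < s.re) : Integrable (fun q : ℝ × ℝ => Φ q * ((|q.1 * q.2| : ℝ) : ℂ) ^ (s - 1)) := by
  refine Integrable.mono' (Φ.integrable_norm_mul_abs_mul_rpow hs)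
    (Φ.continuous.measurable.mul (measurable_abs_mul_cpow _)).aestronglyMeasurable ?_
  filter_upwards [ae_coord_ne_zero] with q hq
  rw [norm_mul, Complex.norm_cpow_eq_rpow_re_of_pos (abs_pos.2 (mul_ne_zero hq.1 hq.2))]
  simp

/-- The Mellin transform of `Φ` in the invariant `xy`. -/
noncomputable def orbitalMellin (Φ : SchwartzMap (ℝ × ℝ) ℂ) (s : ℂ) : ℂ :=
  ∫ q : ℝ × ℝ, Φ q * ((|q.1 * q.2| : ℝ) : ℂ) ^ (s - 1)

theorem abs_log_mul_rpow_le {w ε σ a : ℝ} (hw : 0 < w) (hε : 0 < ε) (h : |σ - a| ≤ ε) :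
    w ^ (σ - 1) * |Real.log w| ≤
      ε⁻¹ * (w ^ (a + 2 * ε - 1) + w ^ (a - 2 * ε - 1) + 2 * w ^ (a - 1)) := by
  have key : ∀ r : ℝ, |r| ≤ ε → w ^ r ≤ w ^ ε + w ^ (-ε) := by
    intro r hr
    rcases le_total 1 w with h1 | h1
    · have := Real.rpow_le_rpow_of_exponent_le h1 (abs_le.1 hr).2
      have : 0 < w ^ (-ε) := by positivity
      linarith
    · have := Real.rpow_le_rpow_of_exponent_ge hw h1 (abs_le.1 hr).1
      have : 0 < w ^ ε := by positivity
      linarith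
  have hlog : |Real.log w| ≤ ε⁻¹ * (w ^ ε + w ^ (-ε)) := by
    have h1 := Real.log_le_rpow_div hw.le hε
    have h2 := Real.log_le_rpow_div (inv_pos.2 hw).le hε
    rw [Real.log_inv, Real.inv_rpow hw.le, ← Real.rpow_neg hw.le] at h2
    have h3 : 0 < w ^ ε / ε := by positivity
    have h4 : 0 < w ^ (-ε) / ε := by positivity
    have h5 : ε⁻¹ * (w ^ ε + w ^ (-ε)) = w ^ ε / ε + w ^ (-ε) / ε := by ring
    rw [h5, abs_le]
    constructor <;> linarith
  have e1 : w ^ (σ - 1) = w ^ (σ - a) * w ^ (a - 1) := by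
    rw [← Real.rpow_add hw]; ring_nf
  have e2 : w ^ (a + 2 * ε - 1) = w ^ ε * w ^ ε * w ^ (a - 1) := by
    rw [← Real.rpow_add hw, ← Real.rpow_add hw]; ring_nf
  have e3 : w ^ (a - 2 * ε - 1) = w ^ (-ε) * w ^ (-ε) * w ^ (a - 1) := by
    rw [← Real.rpow_add hw, ← Real.rpow_add hw]; ring_nf
  have e4 : w ^ ε * w ^ (-ε) = 1 := by
    rw [← Real.rpow_add hw]; simp
  calc w ^ (σ - 1) * |Real.log w|
      ≤ ((w ^ ε + w ^ (-ε)) * w ^ (a - 1)) * (ε⁻¹ * (w ^ ε + w ^ (-ε))) := by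
        rw [e1]
        gcongr
        exact key _ h
    _ = ε⁻¹ * (w ^ ε * w ^ ε * w ^ (a - 1) + w ^ (-ε) * w ^ (-ε) * w ^ (a - 1) +
          2 * (w ^ ε * w ^ (-ε)) * w ^ (a - 1)) := by ring
    _ = _ := by rw [e2, e3, e4, mul_one]

theorem differentiableAt_orbitalMellin (Φ : SchwartzMap (ℝ × ℝ) ℂ) {s : ℂ} (hs : 0 < s.re) :
    DifferentiableAt ℂ (orbitalMellin Φ) s := by
  have hε : 0 < s.re / 3 := by positivity
  have hp := Φ.integrable_norm_mul_abs_mul_rpow (σ := s.re + 2 * (s.re / 3)) (by linarith)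
  have hm := Φ.integrable_norm_mul_abs_mul_rpow (σ := s.re - 2 * (s.re / 3)) (by linarith)
  have h0 := Φ.integrable_norm_mul_abs_mul_rpow hs
  have hlogm : Measurable fun q : ℝ × ℝ => Complex.log ((|q.1 * q.2| : ℝ) : ℂ) := by fun_prop
  refine (hasDerivAt_integral_of_dominated_loc_of_deriv_le
    (F := fun (z : ℂ) (q : ℝ × ℝ) => Φ q * ((|q.1 * q.2| : ℝ) : ℂ) ^ (z - 1))
    (F' := fun (z : ℂ) (q : ℝ × ℝ) => Φ q * (((|q.1 * q.2| : ℝ) : ℂ) ^ (z - 1) *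
      Complex.log ((|q.1 * q.2| : ℝ) : ℂ)))
    (Metric.ball_mem_nhds s hε)
    (.of_forall fun z =>
      (Φ.continuous.measurable.mul (measurable_abs_mul_cpow _)).aestronglyMeasurable)
    (Φ.integrable_mul_abs_mul_cpow hs)
    (Φ.continuous.measurable.mul ((measurable_abs_mul_cpow _).mul hlogm)).aestronglyMeasurable
    ?_ (((hp.add hm).add (h0.const_mul 2)).const_mul (s.re / 3)⁻¹) ?_).2.differentiableAt
  · filter_upwards [ae_coord_ne_zero] with q hq z hz
    have hw : 0 < |q.1 * q.2| := abs_pos.2 (mul_ne_zero hq.1 hq.2)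
    have hz' : |z.re - s.re| ≤ s.re / 3 := by
      rw [← Complex.sub_re]
      exact (Complex.abs_re_le_norm _).trans (mem_ball_iff_norm.1 hz).le
    have := abs_log_mul_rpow_le hw hε hz'
    rw [norm_mul, norm_mul, Complex.norm_cpow_eq_rpow_re_of_pos hw, ← Complex.ofReal_log hw.le,
      Complex.norm_real, Real.norm_eq_abs, Complex.sub_re, Complex.one_re]
    calc _ ≤ ‖Φ q‖ * _ := mul_le_mul_of_nonneg_left this (norm_nonneg _)
      _ = _ := by simp only [Pi.add_apply]; ring
  · filter_upwards [ae_coord_ne_zero] with q hq z hz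
    have hw : ((|q.1 * q.2| : ℝ) : ℂ) ≠ 0 := by
      exact_mod_cast (abs_pos.2 (mul_ne_zero hq.1 hq.2)).ne'
    have := ((hasDerivAt_id z).sub_const 1).const_cpow (c := ((|q.1 * q.2| : ℝ) : ℂ)) (.inl hw)
    simpa using this.const_mul (Φ q)

theorem integral_integral_mul_kernel (Φ : SchwartzMap (ℝ × ℝ) ℂ) {g : ℝ → ℝ → ℝ}
    (hg : Measurable (Function.uncurry g)) (hg0 : ∀ x t, 0 ≤ g x t) {c e : ℂ → ℂ}
    (hc : ∀ s : ℂ, 0 < s.re → s.re < 1 → c s ≠ 0)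
    (he : ∀ s : ℂ, 0 < s.re → s.re < 1 → 0 < (e s).re)
    (H : ∀ s : ℂ, 0 < s.re → s.re < 1 → ∀ x : ℝ, x ≠ 0 →
      ∫ t in Set.Ioi (0 : ℝ), (t : ℂ) ^ ((1 - s) / 2 - 1) * (g x t : ℂ) =
        c s * ((|x| : ℝ) : ℂ) ^ (e s - 1))
    {s : ℂ} (hs0 : 0 < s.re) (hs1 : s.re < 1) :
    ∫ p : ℝ × ℝ, (∫ q : ℝ × ℝ, Φ q *
      (((p.1 : ℂ) ^ ((1 - s) / 2 - 1) * (g q.1 p.1 : ℂ)) *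
        ((p.2 : ℂ) ^ ((1 - s) / 2 - 1) * (g q.2 p.2 : ℂ))))
      ∂((volume.restrict (Set.Ioi (0 : ℝ))).prod (volume.restrict (Set.Ioi (0 : ℝ)))) =
    c s ^ 2 * orbitalMellin Φ (e s) := by
  set ν : Measure ℝ := volume.restrict (Set.Ioi (0 : ℝ))
  set K : ℂ → ℝ → ℝ → ℂ := fun s x t => (t : ℂ) ^ ((1 - s) / 2 - 1) * (g x t : ℂ) with hK
  have hKint : ∀ s : ℂ, 0 < s.re → s.re < 1 → ∀ x : ℝ, x ≠ 0 → Integrable (K s x) ν := by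
    intro s h0 h1 x hx
    refine Integrable.of_integral_ne_zero ?_
    rw [H s h0 h1 x hx]
    exact mul_ne_zero (hc s h0 h1) (by simp [Complex.cpow_eq_zero_iff, hx])
  have hKnorm : ∀ x : ℝ, x ≠ 0 → ∫ t, ‖K s x t‖ ∂ν =
      ‖c s.re‖ * |x| ^ ((e s.re).re - 1) := by
    intro x hx
    have h1 : ((∫ t, ‖K s x t‖ ∂ν : ℝ) : ℂ) = c s.re * ((|x| : ℝ) : ℂ) ^ (e s.re - 1) := by
      rw [← H s.re (by simpa) (by simpa) x hx, ← integral_complex_ofReal]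
      refine setIntegral_congr_fun measurableSet_Ioi fun t ht => ?_
      have ht : 0 < t := ht
      simp only [hK]
      rw [norm_mul, Complex.norm_cpow_eq_rpow_re_of_pos ht, Complex.norm_real,
        Real.norm_of_nonneg (hg0 x t), Complex.ofReal_mul, Complex.ofReal_cpow ht.le]
      simp
    have h2 := congrArg norm h1
    rw [Complex.norm_real, Real.norm_of_nonneg (integral_nonneg fun _ => norm_nonneg _),
      norm_mul, Complex.norm_cpow_eq_rpow_re_of_pos (abs_pos.2 hx)] at h2
    simpa using h2
  have hKm : Measurable fun z : ℝ × ℝ => K s z.1 z.2 := by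
    have := Complex.measurable_ofReal.comp hg
    exact Measurable.mul (by fun_prop) this
  have hFm : Measurable fun z : (ℝ × ℝ) × (ℝ × ℝ) =>
      Φ z.1 * (K s z.1.1 z.2.1 * K s z.1.2 z.2.2) := by
    refine (Φ.continuous.measurable.comp measurable_fst).mul (Measurable.mul ?_ ?_)
    · exact hKm.comp (f := fun z : (ℝ × ℝ) × (ℝ × ℝ) => (z.1.1, z.2.1)) (by fun_prop)
    · exact hKm.comp (f := fun z : (ℝ × ℝ) × (ℝ × ℝ) => (z.1.2, z.2.2)) (by fun_prop)
  have hF : Integrable (fun z : (ℝ × ℝ) × (ℝ × ℝ) =>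
      Φ z.1 * (K s z.1.1 z.2.1 * K s z.1.2 z.2.2)) (volume.prod (ν.prod ν)) := by
    rw [integrable_prod_iff hFm.aestronglyMeasurable]
    constructor
    · filter_upwards [ae_coord_ne_zero] with q hq
      exact ((hKint s hs0 hs1 _ hq.1).mul_prod (hKint s hs0 hs1 _ hq.2)).const_mul (Φ q)
    · have := (Φ.integrable_norm_mul_abs_mul_rpow
        (he s.re (by simpa) (by simpa))).const_mul (‖c s.re‖ ^ 2)
      refine this.congr ?_
      filter_upwards [ae_coord_ne_zero] with q hq
      simp only [norm_mul]
      rw [integral_const_mul, integral_prod_mul (fun t => ‖K s q.1 t‖) (fun t => ‖K s q.2 t‖),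
        hKnorm _ hq.1, hKnorm _ hq.2, abs_mul, Real.mul_rpow (abs_nonneg _) (abs_nonneg _)]
      ring
  have hswap := integral_integral_swap
    (f := fun q p : ℝ × ℝ => Φ q * (K s q.1 p.1 * K s q.2 p.2)) hF
  rw [← hswap, orbitalMellin, ← integral_const_mul]
  refine integral_congr_ae ?_
  filter_upwards [ae_coord_ne_zero] with q hq
  rw [integral_const_mul, integral_prod_mul (fun t => K s q.1 t) (fun t => K s q.2 t),
    H s hs0 hs1 _ hq.1, H s hs0 hs1 _ hq.2, abs_mul, Complex.ofReal_mul,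
    Complex.mul_cpow_ofReal_nonneg (abs_nonneg _) (abs_nonneg _)]
  ring

theorem integral_cpow_mul_exp_neg_mul_sq {a : ℂ} (ha : 0 < a.re) {r x : ℝ} (hr : 0 < r)
    (hx : x ≠ 0) :
    ∫ t in Set.Ioi (0 : ℝ), (t : ℂ) ^ (a - 1) * ((Real.exp (-(t * (r * x) ^ 2)) : ℝ) : ℂ) =
      (r : ℂ) ^ (-(2 * a)) * Complex.Gamma a * ((|x| : ℝ) : ℂ) ^ (-(2 * a)) := by
  have := Complex.integral_cpow_mul_exp_neg_mul_Ioi ha (r := (r * x) ^ 2) (by positivity)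
  have e : (1 / (((r * x) ^ 2 : ℝ) : ℂ)) ^ a =
      (r : ℂ) ^ (-(2 * a)) * ((|x| : ℝ) : ℂ) ^ (-(2 * a)) := by
    rw [← Complex.mul_cpow_ofReal_nonneg hr.le (abs_nonneg _), ← Complex.ofReal_mul,
      show r * |x| = |r * x| by rw [abs_mul, abs_of_pos hr], ← sq_abs (r * x),
      show -(2 * a) = ((-2 : ℝ) : ℂ) * a by push_cast; ring,
      Complex.cpow_def_of_ne_zero (by simp [hr.ne', hx]),
      Complex.cpow_def_of_ne_zero (by simp [hr.ne', hx]), one_div, ← Complex.ofReal_inv,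
      ← Complex.ofReal_log (by positivity), ← Complex.ofReal_log (by positivity), Real.log_inv,
      Real.log_pow]
    push_cast
    ring_nf
  rw [e] at this
  rw [mul_right_comm, ← this]
  refine integral_congr_ae (.of_forall fun t => ?_)
  push_cast
  ring_nf

theorem integral_cpow_mul_dual_gaussian {s : ℂ} (hs : 0 < s.re) {x : ℝ} (hx : x ≠ 0) :
    ∫ t in Set.Ioi (0 : ℝ), (t : ℂ) ^ ((1 - s) / 2 - 1) *
        ((Real.sqrt (Real.pi / t) * Real.exp (-(Real.pi ^ 2 * x ^ 2 / t)) : ℝ) : ℂ) =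
      (Real.sqrt Real.pi : ℂ) * (Real.pi : ℂ) ^ (-s) * Complex.Gamma (s / 2) *
        ((|x| : ℝ) : ℂ) ^ ((1 - s) - 1) := by
  have h1 := integral_cpow_mul_exp_neg_mul_sq (a := s / 2) (by simpa) Real.pi_pos hx
  have h2 := mellin_comp_inv (fun t : ℝ => ((Real.exp (-(t * (Real.pi * x) ^ 2)) : ℝ) : ℂ))
    (-(s / 2))
  rw [neg_neg, mellin, mellin] at h2
  simp only [smul_eq_mul] at h2
  rw [h1] at h2
  rw [show (1 - s) - 1 = -(2 * (s / 2)) by ring, mul_assoc, mul_assoc,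
    show -s = -(2 * (s / 2)) by ring, ← mul_assoc (_ ^ _), ← h2, ← integral_const_mul]
  refine setIntegral_congr_fun measurableSet_Ioi fun t ht => ?_
  have ht : 0 < t := ht
  have e : (t : ℂ) ^ ((1 - s) / 2 - 1) = (t : ℂ) ^ (-(s / 2) - 1) * (Real.sqrt t : ℂ) := by
    rw [Real.sqrt_eq_rpow, Complex.ofReal_cpow ht.le, ← Complex.cpow_add _ _ (by simp [ht.ne'])]
    congr 1
    push_cast
    ring
  have e2 : (Real.sqrt t : ℂ) * (Real.sqrt (Real.pi / t) : ℂ) = Real.sqrt Real.pi := by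
    rw [← Complex.ofReal_mul, ← Real.sqrt_mul ht.le, mul_div_cancel₀ _ ht.ne']
  rw [e, Complex.ofReal_mul, ← e2,
    show -(Real.pi ^ 2 * x ^ 2 / t) = -(t⁻¹ * (Real.pi * x) ^ 2) by ring]
  ring

open scoped FourierTransform in
theorem fourier_dual_gaussian_prod {t u : ℝ} (ht : 0 < t) (hu : 0 < u) (w : WithLp 2 (ℝ × ℝ)) :
    𝓕 (fun v : WithLp 2 (ℝ × ℝ) =>
      (((Real.sqrt (Real.pi / t) * Real.exp (-(Real.pi ^ 2 * v.fst ^ 2 / t)) : ℝ) : ℂ)) *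
      (((Real.sqrt (Real.pi / u) * Real.exp (-(Real.pi ^ 2 * v.snd ^ 2 / u)) : ℝ) : ℂ))) w =
    ((Real.exp (-(t * w.fst ^ 2)) : ℝ) : ℂ) * ((Real.exp (-(u * w.snd ^ 2)) : ℝ) : ℂ) := by
  have one_dim : ∀ {t : ℝ}, 0 < t → ∀ y : ℝ,
      ∫ x : ℝ, Complex.exp (Complex.I * (-(2 * Real.pi * y) : ℂ) * x) *
        ((Real.sqrt (Real.pi / t) * Real.exp (-(Real.pi ^ 2 * x ^ 2 / t)) : ℝ) : ℂ) =
      ((Real.exp (-(t * y ^ 2)) : ℝ) : ℂ) := by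
    intro t ht y
    have hb : 0 < Real.pi ^ 2 / t := by positivity
    have hG := fourierIntegral_gaussian (b := ((Real.pi ^ 2 / t : ℝ) : ℂ))
      (by rwa [Complex.ofReal_re]) (-(2 * Real.pi * y))
    have hpi : (Real.pi : ℂ) ≠ 0 := by exact_mod_cast Real.pi_ne_zero
    have htc : (t : ℂ) ≠ 0 := by exact_mod_cast ht.ne'
    have h1 : ((Real.pi : ℂ) / ((Real.pi ^ 2 / t : ℝ) : ℂ)) ^ (1 / 2 : ℂ) =
        (Real.sqrt (t / Real.pi) : ℂ) := by
      rw [Real.sqrt_eq_rpow, Complex.ofReal_cpow (by positivity)]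
      congr 1
      · push_cast
        field_simp
      · push_cast; rfl
    have h2 : (Real.sqrt (Real.pi / t) : ℂ) * (Real.sqrt (t / Real.pi) : ℂ) = 1 := by
      rw [← Complex.ofReal_mul, ← Real.sqrt_mul (by positivity),
        show Real.pi / t * (t / Real.pi) = 1 by field_simp]
      simp
    have h3 : -(-(2 * Real.pi * y) : ℂ) ^ 2 / (4 * ((Real.pi ^ 2 / t : ℝ) : ℂ)) =
        ((-(t * y ^ 2) : ℝ) : ℂ) := by
      push_cast
      field_simp
      ring
    rw [h1, h3] at hG
    rw [Complex.ofReal_exp, ← one_mul (Complex.exp ((-(t * y ^ 2) : ℝ) : ℂ)), ← h2,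
      mul_assoc (Real.sqrt (Real.pi / t) : ℂ), ← hG, ← integral_const_mul]
    refine integral_congr_ae (.of_forall fun x => ?_)
    simp only
    push_cast
    ring_nf
  rw [Real.fourier_eq', ← (WithLp.volume_preserving_toLp ℝ ℝ).integral_comp
    (MeasurableEquiv.toLp 2 (ℝ × ℝ)).measurableEmbedding, ← one_dim ht, ← one_dim hu,
    Measure.volume_eq_prod, ← integral_prod_mul]
  refine integral_congr_ae (.of_forall fun q => ?_)
  simp only [smul_eq_mul, WithLp.prod_inner_apply]
  rw [mul_mul_mul_comm, ← Complex.exp_add]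
  congr 2
  simp
  ring

open scoped FourierTransform in
theorem SchwartzMap.exists_gaussian_dual (Φ : SchwartzMap (ℝ × ℝ) ℂ) :
    ∃ Ψ : SchwartzMap (ℝ × ℝ) ℂ, ∫ q, Ψ q = Φ (0, 0) ∧ ∀ t u : ℝ, 0 < t → 0 < u →
      ∫ q : ℝ × ℝ, Φ q * (((Real.exp (-(t * q.1 ^ 2)) : ℝ) : ℂ) *
        ((Real.exp (-(u * q.2 ^ 2)) : ℝ) : ℂ)) =
      ∫ q : ℝ × ℝ, Ψ q *
        (((Real.sqrt (Real.pi / t) * Real.exp (-(Real.pi ^ 2 * q.1 ^ 2 / t)) : ℝ) : ℂ) *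
        ((Real.sqrt (Real.pi / u) * Real.exp (-(Real.pi ^ 2 * q.2 ^ 2 / u)) : ℝ) : ℂ)) := by
  set L := WithLp.prodContinuousLinearEquiv 2 ℝ ℝ ℝ with hL
  set f : SchwartzMap (WithLp 2 (ℝ × ℝ)) ℂ :=
    SchwartzMap.compCLMOfContinuousLinearEquiv ℂ L Φ with hf
  have emb := (MeasurableEquiv.toLp 2 (ℝ × ℝ)).measurableEmbedding
  have hv := WithLp.volume_preserving_toLp ℝ ℝ
  have tr : ∀ F : WithLp 2 (ℝ × ℝ) → ℂ, ∫ q, F (WithLp.toLp 2 q) = ∫ v, F v :=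
    fun F => hv.integral_comp emb F
  refine ⟨SchwartzMap.compCLMOfContinuousLinearEquiv ℂ L.symm (𝓕 f), ?_, fun t u ht hu => ?_⟩
  · have h1 : 𝓕⁻ (𝓕 f) = f := FourierTransform.fourierInv_fourier_eq f
    have h2 : (𝓕⁻ (𝓕 f)) 0 = ∫ v, (𝓕 f) v := by
      rw [SchwartzMap.fourierInv_coe, Real.fourierInv_eq]
      simp
    rw [h1] at h2
    have h3 : f 0 = Φ (0, 0) := by simp [hf, hL]; rfl
    rw [← h3, h2, ← tr]
    rfl
  · have hint : Integrable (fun v : WithLp 2 (ℝ × ℝ) =>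
      (((Real.sqrt (Real.pi / t) * Real.exp (-(Real.pi ^ 2 * v.fst ^ 2 / t)) : ℝ) : ℂ)) *
      (((Real.sqrt (Real.pi / u) * Real.exp (-(Real.pi ^ 2 * v.snd ^ 2 / u)) : ℝ) : ℂ))) := by
      have one_dim : ∀ {t : ℝ}, 0 < t → Integrable (fun x : ℝ =>
          ((Real.sqrt (Real.pi / t) * Real.exp (-(Real.pi ^ 2 * x ^ 2 / t)) : ℝ) : ℂ)) := by
        intro t ht
        have := ((integrable_exp_neg_mul_sq (b := Real.pi ^ 2 / t)
          (by positivity)).const_mul (Real.sqrt (Real.pi / t))).ofReal (𝕜 := ℂ)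
        refine this.congr (.of_forall fun x => ?_)
        simp only [Complex.coe_algebraMap, RCLike.ofReal_mul]
        push_cast
        ring_nf
      rw [← hv.integrable_comp_emb emb]
      exact (one_dim ht).mul_prod (one_dim hu)
    have flip := VectorFourier.integral_fourierIntegral_smul_eq_flip
      (L := innerₗ (WithLp 2 (ℝ × ℝ))) (μ := volume) (ν := volume)
      Real.continuous_fourierChar continuous_inner f.integrable hint
    rw [flip_innerₗ] at flip
    calc _ = ∫ v : WithLp 2 (ℝ × ℝ), f v * (((Real.exp (-(t * v.fst ^ 2)) : ℝ) : ℂ) *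
          ((Real.exp (-(u * v.snd ^ 2)) : ℝ) : ℂ)) := by rw [← tr]; rfl
      _ = _ := by
        refine Eq.trans ?_ flip.symm
        refine integral_congr_ae (.of_forall fun v => ?_)
        simp only [smul_eq_mul]
        rw [← fourier_dual_gaussian_prod ht hu v]
        rfl
      _ = _ := by rw [← tr]; rfl

theorem exists_orbitalMellin_functional_equation (Φ : SchwartzMap (ℝ × ℝ) ℂ) :
    ∃ Ψ : SchwartzMap (ℝ × ℝ) ℂ, orbitalMellin Ψ 1 = Φ (0, 0) ∧
      ∀ s : ℂ, 0 < s.re → s.re < 1 →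
        Complex.Gamma ((1 - s) / 2) ^ 2 * orbitalMellin Φ s =
          ((Real.sqrt Real.pi : ℂ) * (Real.pi : ℂ) ^ (-s) * Complex.Gamma (s / 2)) ^ 2 *
            orbitalMellin Ψ (1 - s) := by
  obtain ⟨Ψ, hΨ, hdual⟩ := Φ.exists_gaussian_dual
  refine ⟨Ψ, by simpa [orbitalMellin] using hΨ, fun s hs0 hs1 => ?_⟩
  have h1 := integral_integral_mul_kernel Φ
    (g := fun x t => Real.exp (-(t * x ^ 2))) (c := fun s => Complex.Gamma ((1 - s) / 2))
    (e := fun s => s) (by unfold Function.uncurry; fun_prop) (fun x t => by positivity)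
    (fun s _ h => Complex.Gamma_ne_zero_of_re_pos (by simpa using h)) (fun s h _ => h)
    (fun s _ h x hx => by
      have := integral_cpow_mul_exp_neg_mul_sq (a := (1 - s) / 2) (by simpa using h) one_pos hx
      rw [show -(2 * ((1 - s) / 2)) = s - 1 by ring] at this
      simpa using this) hs0 hs1
  have h2 := integral_integral_mul_kernel Ψ
    (g := fun x t => Real.sqrt (Real.pi / t) * Real.exp (-(Real.pi ^ 2 * x ^ 2 / t)))
    (c := fun s => (Real.sqrt Real.pi : ℂ) * (Real.pi : ℂ) ^ (-s) * Complex.Gamma (s / 2))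
    (e := fun s => 1 - s) (by unfold Function.uncurry; fun_prop) (fun x t => by positivity)
    (fun s h _ => mul_ne_zero (mul_ne_zero (by simp [Real.sqrt_eq_zero', Real.pi_pos])
      (by simp [Complex.cpow_eq_zero_iff, Real.pi_ne_zero]))
      (Complex.Gamma_ne_zero_of_re_pos (by simpa using h)))
    (fun s _ h => by simpa using h)
    (fun s h _ x hx => integral_cpow_mul_dual_gaussian h hx) hs0 hs1
  rw [← h1, ← h2, Measure.prod_restrict]
  refine setIntegral_congr_fun (measurableSet_Ioi.prod measurableSet_Ioi) fun p hp => ?_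
  have h3 := congrArg (fun z : ℂ => (p.1 : ℂ) ^ ((1 - s) / 2 - 1) *
    (p.2 : ℂ) ^ ((1 - s) / 2 - 1) * z) (hdual p.1 p.2 hp.1 hp.2)
  simp only [← integral_const_mul] at h3
  refine Eq.trans ?_ (h3.trans ?_)
  · exact integral_congr_ae (.of_forall fun q => by ring)
  · exact integral_congr_ae (.of_forall fun q => by ring)

theorem exists_entire_orbitalMellin_eq (Φ : SchwartzMap (ℝ × ℝ) ℂ) :
    ∃ G : ℂ → ℂ, Differentiable ℂ G ∧ G 0 = Φ (0, 0) ∧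
      ∀ s : ℂ, 0 < s.re → orbitalMellin Φ s = Complex.Gamma (s / 2) ^ 2 * G s := by
  obtain ⟨Ψ, hΨ, hfe⟩ := exists_orbitalMellin_functional_equation Φ
  have hpi : (Real.pi : ℂ) ≠ 0 := by exact_mod_cast Real.pi_ne_zero
  set A : ℂ → ℂ := fun s => (Complex.Gamma (s / 2))⁻¹ ^ 2 * orbitalMellin Φ s with hA
  set B : ℂ → ℂ := fun s => (Complex.Gamma ((1 - s) / 2))⁻¹ ^ 2 *
    (((Real.sqrt Real.pi : ℂ) * (Real.pi : ℂ) ^ (-s)) ^ 2 * orbitalMellin Ψ (1 - s)) with hB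
  have hAB : ∀ s : ℂ, 0 < s.re → s.re < 1 → A s = B s := by
    intro s h0 h1
    have g1 : Complex.Gamma (s / 2) ≠ 0 := Complex.Gamma_ne_zero_of_re_pos (by simpa using h0)
    have g2 : Complex.Gamma ((1 - s) / 2) ≠ 0 :=
      Complex.Gamma_ne_zero_of_re_pos (by simpa using h1)
    have := hfe s h0 h1
    simp only [hA, hB]
    field_simp
    linear_combination this
  have hdA : ∀ s : ℂ, 0 < s.re → DifferentiableAt ℂ A s := fun s hs =>
    ((Complex.differentiable_one_div_Gamma.comp
      (differentiable_id.div_const 2)).differentiableAt.pow 2).mul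
      (differentiableAt_orbitalMellin Φ hs)
  have hdB : ∀ s : ℂ, s.re < 1 → DifferentiableAt ℂ B s := by
    intro s hs
    have hM : DifferentiableAt ℂ (fun s : ℂ => orbitalMellin Ψ (1 - s)) s :=
      (differentiableAt_orbitalMellin Ψ (s := 1 - s) (by simpa using hs)).comp s (by fun_prop)
    refine ((Complex.differentiable_one_div_Gamma.comp
      (((differentiable_const 1).sub differentiable_id).div_const 2)).differentiableAt.pow 2).mul
      (DifferentiableAt.mul (DifferentiableAt.pow (DifferentiableAt.const_mul ?_ _) 2) hM)
    exact DifferentiableAt.const_cpow (by fun_prop) (.inl hpi)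
  refine ⟨fun s => if 0 < s.re then A s else B s, fun s => ?_, ?_, fun s hs => ?_⟩
  · by_cases hs : 0 < s.re
    · refine (hdA s hs).congr_of_eventuallyEq ?_
      filter_upwards [(isOpen_lt continuous_const Complex.continuous_re).mem_nhds hs] with z hz
      exact if_pos hz
    · have hs1 : s.re < 1 := by linarith
      refine (hdB s hs1).congr_of_eventuallyEq ?_
      filter_upwards [(isOpen_lt Complex.continuous_re continuous_const).mem_nhds hs1] with z hz
      split_ifs with h
      · exact hAB z h hz
      · rfl
  · have hsq : (Real.sqrt Real.pi : ℂ) ^ 2 = Real.pi := by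
      rw [← Complex.ofReal_pow, Real.sq_sqrt Real.pi_pos.le]
    have hG : Complex.Gamma (1 / 2) ^ 2 = Real.pi := by
      rw [Complex.Gamma_one_half_eq, ← Complex.cpow_nat_mul]
      simp
    simp only [Complex.zero_re, lt_irrefl, if_false, hB, sub_zero, neg_zero, Complex.cpow_zero,
      mul_one, hΨ, hsq, inv_pow, hG]
    field_simp
  · have g1 : Complex.Gamma (s / 2) ≠ 0 := Complex.Gamma_ne_zero_of_re_pos (by simpa using hs)
    simp only [if_pos hs, hA]
    field_simp


/-- The Mellin transform in the invariant `ξ = xy` of split orbital integrals of a Schwartz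
function on `ℝ²`: `Z(s) = ∫ Φ(x,y)|xy|^{s-1} dx dy` converges for `Re s > 0` and equals
`Γ(s/2)²·G(s)` with `G` entire and `G(0) = Φ(0,0)`; in particular `δ²Z(δ) → 4Φ(0,0)` as
`δ → 0⁺`. -/
theorem stmt_8 (Φ : SchwartzMap (ℝ × ℝ) ℂ) :
    (∀ s : ℂ, 0 < s.re →
      Integrable (fun q : ℝ × ℝ => Φ q * ((|q.1 * q.2| : ℝ) : ℂ) ^ (s - 1))) ∧
    ∃ G : ℂ → ℂ, Differentiable ℂ G ∧ G 0 = Φ (0, 0) ∧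
      (∀ s : ℂ, 0 < s.re →
        (∫ q : ℝ × ℝ, Φ q * ((|q.1 * q.2| : ℝ) : ℂ) ^ (s - 1)) =
          Complex.Gamma (s / 2) ^ 2 * G s) ∧
      Filter.Tendsto
        (fun δ : ℝ => (δ : ℂ) ^ 2 *
          ∫ q : ℝ × ℝ, Φ q * ((|q.1 * q.2| : ℝ) : ℂ) ^ ((δ : ℂ) - 1))
        (nhdsWithin 0 (Set.Ioi 0)) (nhds (4 * Φ (0, 0))) := by
  refine ⟨fun s hs => Φ.integrable_mul_abs_mul_cpow hs, ?_⟩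
  obtain ⟨G, hG, hG0, hGs⟩ := exists_entire_orbitalMellin_eq Φ
  refine ⟨G, hG, hG0, hGs, ?_⟩
  have hg : ContinuousAt Complex.Gamma 1 :=
    (Complex.differentiableAt_Gamma_one).continuousAt
  have hcont : ContinuousAt (fun δ : ℝ => 4 * Complex.Gamma ((δ : ℂ) / 2 + 1) ^ 2 * G δ) 0 := by
    refine (continuousAt_const.mul (ContinuousAt.pow ?_ 2)).mul ?_
    · exact ContinuousAt.comp (f := fun δ : ℝ => (δ : ℂ) / 2 + 1) (by simpa using hg)
        (by fun_prop)
    · exact (hG.continuous.comp Complex.continuous_ofReal).continuousAt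
  have hlim := hcont.tendsto.mono_left (nhdsWithin_le_nhds (s := Set.Ioi 0))
  simp only [Complex.ofReal_zero, zero_div, zero_add, Complex.Gamma_one, one_pow, mul_one,
    hG0] at hlim
  refine hlim.congr' ?_
  filter_upwards [self_mem_nhdsWithin] with δ hδ
  have hδ : 0 < δ := hδ
  have h := hGs δ (by simpa using hδ)
  rw [orbitalMellin] at h
  rw [h, Complex.Gamma_add_one _ (by simp [hδ.ne'])]
  ring
end

section
/- Let Φ : ℝ² → ℂ be a Schwartz function. Then for every complex number s with Re(s) > 0 the integral Z(s) = ∫_{ℝ²} Φ(x,y)·(x² + y²)^{s−1} dx dy converges absolutely, and there exists an entire function G : ℂ → ℂ with G(0) = π·Φ(0,0) such that Z(s) = Γ(s)·G(s) for all s with Re(s) > 0. In particular Z extends meromorphically to ℂ with at most simple poles, located at s = 0, −1, −2, …, and lim_{δ→0⁺} δ·Z(δ) = π·Φ(0,0). -/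
open MeasureTheory
open Asymptotics Filter Topology
open scoped Nat

theorem ContDiff.iteratedDeriv_comp_smul_right {E F : Type*} [NormedAddCommGroup E]
    [NormedSpace ℝ E] [NormedAddCommGroup F] [NormedSpace ℝ F] {f : E → F} {n : ℕ}
    (hf : ContDiff ℝ n f) (u : E) (t : ℝ) :
    iteratedDeriv n (fun r : ℝ => f (r • u)) t = iteratedFDeriv ℝ n f (t • u) (fun _ => u) := by
  have h := ((ContinuousLinearMap.id ℝ ℝ).smulRight u).iteratedFDeriv_comp_right hf t le_rfl
  have e : (fun r : ℝ => f (r • u)) = f ∘ ((ContinuousLinearMap.id ℝ ℝ).smulRight u) := by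
    ext; simp
  rw [iteratedDeriv_eq_iteratedFDeriv, e, h]
  simp

namespace SchwartzMap

theorem norm_sub_taylor_smul_le {E F : Type*} [NormedAddCommGroup E]
    [NormedSpace ℝ E] [NormedAddCommGroup F] [NormedSpace ℝ F] (Φ : SchwartzMap E F) (n : ℕ)
    {u : E} (hu : ‖u‖ ≤ 1) {r : ℝ} (hr : r ∈ Set.Icc (0 : ℝ) 1) :
    ‖Φ (r • u) - ∑ k ∈ Finset.range (n + 1),
        r ^ k • ((k ! : ℝ)⁻¹ • iteratedFDeriv ℝ k Φ 0 (fun _ => u))‖ ≤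
      SchwartzMap.seminorm ℝ 0 (n + 1) Φ * r ^ (n + 1) / n ! := by
  have hf : ContDiff ℝ (⊤ : ℕ∞) (fun r : ℝ => Φ (r • u)) :=
    (Φ.smooth ⊤).comp (f := fun r : ℝ => r • u) (contDiff_id.smul contDiff_const)
  have key (k : ℕ) {t : ℝ} (ht : t ∈ Set.Icc (0 : ℝ) 1) :
      iteratedDerivWithin k (fun r : ℝ => Φ (r • u)) (Set.Icc 0 1) t =
        iteratedFDeriv ℝ k Φ (t • u) (fun _ => u) := by
    rw [iteratedDerivWithin_eq_iteratedDeriv (uniqueDiffOn_Icc zero_lt_one)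
      (hf.contDiffAt.of_le (by exact_mod_cast le_top)) ht,
      ContDiff.iteratedDeriv_comp_smul_right (Φ.smooth k)]
  have h := taylor_mean_remainder_bound (f := fun r : ℝ => Φ (r • u)) (a := 0) (b := 1) (n := n)
    (C := SchwartzMap.seminorm ℝ 0 (n + 1) Φ) zero_le_one
    (hf.of_le (by exact_mod_cast le_top)).contDiffOn hr fun y hy => by
      rw [key _ hy]
      refine (ContinuousMultilinearMap.le_opNorm _ _).trans ?_
      refine (mul_le_of_le_one_right (norm_nonneg _)
        (Finset.prod_le_one (fun _ _ => norm_nonneg _) fun _ _ => hu)).trans ?_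
      exact Φ.norm_iteratedFDeriv_le_seminorm ℝ _ _
  rw [taylor_within_apply] at h
  simp only [sub_zero] at h
  convert! h using 4 with k
  rw [key k (by simp), zero_smul, smul_smul, mul_comm]

theorem exists_norm_le_inv_one_add_pow {E F : Type*} [NormedAddCommGroup E]
    [NormedSpace ℝ E] [NormedAddCommGroup F] [NormedSpace ℝ F] (Φ : SchwartzMap E F) (n : ℕ) :
    ∃ C, ∀ x, ‖Φ x‖ ≤ C * ((1 + ‖x‖) ^ n)⁻¹ := by
  refine ⟨2 ^ n * (Finset.Iic (n, 0)).sup (fun m => SchwartzMap.seminorm ℝ m.1 m.2) Φ,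
    fun x => ?_⟩
  have h := one_add_le_sup_seminorm_apply (𝕜 := ℝ) (m := (n, 0)) le_rfl le_rfl Φ x
  rw [norm_iteratedFDeriv_zero] at h
  rw [← div_eq_mul_inv, le_div_iff₀' (by positivity)]
  exact h

end SchwartzMap

/-- The entire function `s ↦ 1 / ((s + k) Γ(s))`, with its removable singularity filled in. -/
noncomputable def invAddNatMulGamma (k : ℕ) (s : ℂ) : ℂ :=
  (∏ j ∈ Finset.range k, (s + j)) * (Complex.Gamma (s + k + 1))⁻¹

theorem differentiable_invAddNatMulGamma (k : ℕ) : Differentiable ℂ (invAddNatMulGamma k) := by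
  refine Differentiable.mul (by fun_prop) ?_
  exact Complex.differentiable_one_div_Gamma.comp (f := fun s : ℂ => s + k + 1) (by fun_prop)

theorem prod_mul_inv_Gamma_add_natCast (k : ℕ) (s : ℂ) :
    (∏ j ∈ Finset.range k, (s + j)) * (Complex.Gamma (s + k))⁻¹ = (Complex.Gamma s)⁻¹ := by
  induction k with
  | zero => simp
  | succ k ih =>
    rw [Finset.prod_range_succ, ← ih, mul_assoc,
      Complex.one_div_Gamma_eq_self_mul_one_div_Gamma_add_one (s + k)]
    push_cast
    ring_nf

theorem invAddNatMulGamma_eq (k : ℕ) {s : ℂ} (hs : s + k ≠ 0) :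
    invAddNatMulGamma k s = (s + k)⁻¹ * (Complex.Gamma s)⁻¹ := by
  rw [invAddNatMulGamma, ← prod_mul_inv_Gamma_add_natCast k s,
    Complex.one_div_Gamma_eq_self_mul_one_div_Gamma_add_one (s + k)]
  field_simp

theorem invAddNatMulGamma_apply_zero (k : ℕ) :
    invAddNatMulGamma k 0 = if k = 0 then 1 else 0 := by
  rcases k with _ | k
  · simp [invAddNatMulGamma]
  · simp [invAddNatMulGamma, Finset.prod_range_succ']

/-- The remainder of `f` after removing the first `N` terms of `∑ b k * r ^ (2 * k)` on `(0, 1]`. -/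
noncomputable def evenRemainder (f : ℝ → ℂ) (b : ℕ → ℂ) (N : ℕ) (r : ℝ) : ℂ :=
  f r - ∑ k ∈ Finset.range N,
    b k * (Set.Ioc (0 : ℝ) 1).indicator (fun t => (t : ℂ) ^ (2 * k : ℂ)) r

theorem evenRemainder_succ (f : ℝ → ℂ) (b : ℕ → ℂ) (N : ℕ) :
    evenRemainder f b N = fun r => evenRemainder f b (N + 1) r +
      b N • (Set.Ioc (0 : ℝ) 1).indicator (fun t => (t : ℂ) ^ (2 * N : ℂ)) r := by
  ext r
  simp only [evenRemainder, Finset.sum_range_succ, smul_eq_mul]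
  ring

theorem locallyIntegrableOn_evenRemainder {f : ℝ → ℂ} {b : ℕ → ℂ}
    (hfc : LocallyIntegrableOn f (Set.Ioi 0)) (N : ℕ) :
    LocallyIntegrableOn (evenRemainder f b N) (Set.Ioi 0) := by
  induction N with
  | zero => simpa [show evenRemainder f b 0 = f from funext fun r => by simp [evenRemainder]]
      using hfc
  | succ N ih =>
    have h : evenRemainder f b (N + 1) = evenRemainder f b N - fun r =>
        b N • (Set.Ioc (0 : ℝ) 1).indicator (fun t => (t : ℂ) ^ (2 * N : ℂ)) r := by
      rw [evenRemainder_succ f b N]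
      ext r
      simp
    rw [h]
    refine ih.sub (LocallyIntegrable.locallyIntegrableOn (Integrable.locallyIntegrable ?_) _)
    refine Integrable.smul (b N) (f := (Set.Ioc (0 : ℝ) 1).indicator _) ?_
    rw [integrable_indicator_iff measurableSet_Ioc]
    have : Continuous fun t : ℝ => (t : ℂ) ^ (2 * N : ℂ) := by
      have h2 : (fun t : ℝ => (t : ℂ) ^ (2 * N : ℂ)) = fun t : ℝ => (t : ℂ) ^ (2 * N) := by
        ext t
        exact_mod_cast Complex.cpow_natCast (t : ℂ) (2 * N)
      rw [h2]
      fun_prop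
    exact (this.integrableOn_Icc).mono_set Set.Ioc_subset_Icc_self

theorem evenRemainder_isBigO_atTop {f : ℝ → ℂ} {b : ℕ → ℂ} {a : ℝ}
    (hf : f =O[atTop] (· ^ (-a))) (N : ℕ) :
    evenRemainder f b N =O[atTop] (· ^ (-a)) := by
  refine hf.congr' ?_ .rfl
  filter_upwards [eventually_gt_atTop 1] with r hr
  simp [evenRemainder, hr]

theorem evenRemainder_isBigO_zero {f : ℝ → ℂ} {b : ℕ → ℂ} {N : ℕ}
    (hf : (fun r => f r - ∑ k ∈ Finset.range N, b k * (r : ℂ) ^ (2 * k))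
      =O[𝓝[>] 0] fun r => r ^ (2 * N)) :
    evenRemainder f b N =O[𝓝[>] 0] (· ^ (-(-2 * N : ℝ))) := by
  refine hf.congr' ?_ ?_
  · filter_upwards [Ioc_mem_nhdsGT zero_lt_one] with r hr
    rw [evenRemainder]
    congr 1
    refine Finset.sum_congr rfl fun k _ => ?_
    rw [Set.indicator_of_mem hr]
    congr 1
    exact_mod_cast (Complex.cpow_natCast (r : ℂ) (2 * k)).symm
  · refine .of_forall fun r => ?_
    dsimp only
    rw [← Real.rpow_natCast]
    congr 1
    push_cast
    ring

/-- Mellin transform of an even expansion: `mellin f (2 s)` is `Γ(s)` times an entire function. -/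
theorem exists_entire_mellin_eq_Gamma_mul {f : ℝ → ℂ} {b : ℕ → ℂ}
    (hfc : LocallyIntegrableOn f (Set.Ioi 0))
    (hf_top : ∀ a : ℝ, f =O[atTop] (· ^ (-a)))
    (hf_bot : ∀ N, (fun r => f r - ∑ k ∈ Finset.range N, b k * (r : ℂ) ^ (2 * k))
      =O[𝓝[>] 0] fun r => r ^ (2 * N)) :
    ∃ G : ℂ → ℂ, Differentiable ℂ G ∧ G 0 = b 0 / 2 ∧
      ∀ s : ℂ, 0 < s.re → mellin f (2 * s) = Complex.Gamma s * G s := by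
  have hconv (N : ℕ) {s : ℂ} (hs : -(N : ℝ) < s.re) :
      MellinConvergent (evenRemainder f b N) (2 * s) :=
    mellinConvergent_of_isBigO_rpow (locallyIntegrableOn_evenRemainder hfc N)
      (evenRemainder_isBigO_atTop (hf_top _) N) (lt_add_one _)
      (evenRemainder_isBigO_zero (hf_bot N)) (by simp; linarith)
  have hdiff (N : ℕ) {s : ℂ} (hs : -(N : ℝ) < s.re) :
      DifferentiableAt ℂ (fun s => mellin (evenRemainder f b N) (2 * s)) s :=
    DifferentiableAt.comp (f := fun s : ℂ => 2 * s) (g := mellin _) s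
      (mellin_differentiableAt_of_isBigO_rpow
      (locallyIntegrableOn_evenRemainder hfc N)
      (evenRemainder_isBigO_atTop (hf_top _) N) (lt_add_one _)
      (evenRemainder_isBigO_zero (hf_bot N)) (by simp; linarith)) (by fun_prop)
  have hsucc (N : ℕ) {s : ℂ} (hs : -(N : ℝ) < s.re) :
      mellin (evenRemainder f b N) (2 * s) =
        mellin (evenRemainder f b (N + 1)) (2 * s) + b N / 2 * (s + N)⁻¹ := by
    have h1 := hasMellin_cpow_Ioc (2 * N : ℂ) (s := 2 * s) (by simp; linarith)
    have h2 := hasMellin_const_smul h1.1 (b N)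
    rw [evenRemainder_succ f b N,
      (hasMellin_add (hconv (N + 1) (s := s) (by push_cast; linarith)) h2.1).2, h2.2, h1.2,
      ← mul_add, smul_eq_mul]
    simp only [one_div, mul_inv]
    ring
  set H : ℕ → ℂ → ℂ := fun N s => mellin (evenRemainder f b N) (2 * s) * (Complex.Gamma s)⁻¹ +
    ∑ k ∈ Finset.range N, b k / 2 * invAddNatMulGamma k s with hH
  have hHsucc (N : ℕ) {s : ℂ} (hs : -(N : ℝ) < s.re) : H (N + 1) s = H N s := by
    have h0 : s + N ≠ 0 := fun h => by
      have := congrArg Complex.re h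
      simp at this
      linarith
    simp only [hH, hsucc N hs, Finset.sum_range_succ, invAddNatMulGamma_eq N h0]
    ring
  have hHle {M N : ℕ} (hMN : M ≤ N) {s : ℂ} (hs : -(M : ℝ) < s.re) : H N s = H M s := by
    induction N, hMN using Nat.le_induction with
    | base => rfl
    | succ N hMN ih =>
      have : (M : ℝ) ≤ N := mod_cast hMN
      rw [hHsucc N (by linarith), ih]
  have hHdiff (N : ℕ) {s : ℂ} (hs : -(N : ℝ) < s.re) : DifferentiableAt ℂ (H N) s :=
    ((hdiff N hs).mul (Complex.differentiable_one_div_Gamma s)).add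
      (.fun_sum fun k _ => ((differentiable_invAddNatMulGamma k) s).const_mul _)
  have hfloor (s : ℂ) : -((⌊-s.re⌋₊ + 1 : ℕ) : ℝ) < s.re := by
    have := Nat.lt_floor_add_one (-s.re)
    push_cast
    linarith
  have hGH (N : ℕ) {s : ℂ} (hs : -(N : ℝ) < s.re) : H (⌊-s.re⌋₊ + 1) s = H N s := by
    rcases le_total N (⌊-s.re⌋₊ + 1) with h | h
    · exact hHle h hs
    · exact (hHle h (hfloor s)).symm
  refine ⟨fun s => H (⌊-s.re⌋₊ + 1) s, fun s => ?_, ?_, fun s hs => ?_⟩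
  · refine (hHdiff _ (hfloor s)).congr_of_eventuallyEq ?_
    filter_upwards [(isOpen_lt continuous_const Complex.continuous_re).mem_nhds (hfloor s)]
      with z hz using hGH _ hz
  · simp [hH, invAddNatMulGamma_apply_zero]
  · simp only [hGH 0 (s := s) (by simpa using hs)]
    have : Complex.Gamma s ≠ 0 := Complex.Gamma_ne_zero_of_re_pos hs
    have h0 : evenRemainder f b 0 = f := by ext; simp [evenRemainder]
    simp only [hH, h0, Finset.range_zero, Finset.sum_empty, add_zero]
    field_simp

theorem integrable_of_integrableOn_polarCoord {E : Type*} [NormedAddCommGroup E] [NormedSpace ℝ E]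
    {f : ℝ × ℝ → E}
    (hf : IntegrableOn (fun p => p.1 • f (polarCoord.symm p)) polarCoord.target) :
    Integrable f := by
  rw [← integrableOn_univ, ← integrableOn_congr_set_ae polarCoord_source_ae_eq_univ,
    ← polarCoord.symm_image_target_eq_source,
    integrableOn_image_iff_integrableOn_abs_det_fderiv_smul volume
      polarCoord.open_target.measurableSet
      (fun p _ => (hasFDerivAt_polarCoord_symm p).hasFDerivWithinAt) polarCoord.symm.injOn]
  refine hf.congr_fun (fun p hp => ?_) polarCoord.open_target.measurableSet
  rw [det_fderivPolarCoordSymm, abs_of_pos hp.1]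

theorem half_le_norm_polarCoord_symm (r θ : ℝ) :
    r / 2 ≤ ‖(r * Real.cos θ, r * Real.sin θ)‖ := by
  rw [Prod.norm_def]
  set m := max ‖r * Real.cos θ‖ ‖r * Real.sin θ‖
  have h1 : |r * Real.cos θ| ≤ m := le_max_left _ _
  have h2 : |r * Real.sin θ| ≤ m := le_max_right _ _
  have hm : 0 ≤ m := (abs_nonneg _).trans h1
  refine le_of_sq_le_sq ?_ hm
  nlinarith [Real.sin_sq_add_cos_sq θ, sq_abs (r * Real.cos θ), sq_abs (r * Real.sin θ),
    pow_le_pow_left₀ (abs_nonneg _) h1 2, pow_le_pow_left₀ (abs_nonneg _) h2 2,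
    mul_pow r (Real.cos θ) 2]

theorem Complex.mul_ofReal_sq_cpow_sub_one {r : ℝ} (hr : 0 < r) (s : ℂ) :
    (r : ℂ) * ((r ^ 2 : ℝ) : ℂ) ^ (s - 1) = (r : ℂ) ^ (2 * s - 1) := by
  have h0 : (r : ℂ) ≠ 0 := mod_cast hr.ne'
  rw [pow_two, Complex.ofReal_mul, Complex.mul_cpow_ofReal_nonneg hr.le hr.le]
  nth_rw 1 [← Complex.cpow_one (r : ℂ)]
  rw [← Complex.cpow_add _ _ h0, ← Complex.cpow_add _ _ h0]
  congr 1
  ring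

namespace SchwartzMap

theorem exists_norm_polarCoord_symm_le (Φ : SchwartzMap (ℝ × ℝ) ℂ) (n : ℕ) :
    ∃ C, 0 ≤ C ∧ ∀ r θ : ℝ, 0 < r →
      ‖Φ (r * Real.cos θ, r * Real.sin θ)‖ ≤ C * ((1 + r) ^ n)⁻¹ := by
  obtain ⟨C, hC⟩ := Φ.exists_norm_le_inv_one_add_pow n
  have hC0 : 0 ≤ C := by simpa using (norm_nonneg _).trans (hC 0)
  refine ⟨C * 2 ^ n, by positivity, fun r θ hr => (hC _).trans ?_⟩
  rw [mul_assoc]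
  refine mul_le_mul_of_nonneg_left ?_ hC0
  rw [← div_eq_mul_inv, ← div_pow, ← inv_pow]
  refine pow_le_pow_left₀ (by positivity) ?_ n
  rw [inv_eq_one_div, div_le_div_iff₀ (by positivity) (by positivity)]
  linarith [half_le_norm_polarCoord_symm r θ]

/-- The integral of `Φ` over the circle of radius `r`, with respect to the angle. -/
noncomputable def angularIntegral (Φ : SchwartzMap (ℝ × ℝ) ℂ) (r : ℝ) : ℂ :=
  ∫ θ in -Real.pi..Real.pi, Φ (r * Real.cos θ, r * Real.sin θ)

theorem continuous_angularIntegral (Φ : SchwartzMap (ℝ × ℝ) ℂ) :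
    Continuous Φ.angularIntegral := by
  refine intervalIntegral.continuous_parametric_intervalIntegral_of_continuous' ?_ _ _
  have := Φ.continuous
  fun_prop

theorem angularIntegral_isBigO_atTop (Φ : SchwartzMap (ℝ × ℝ) ℂ) (a : ℝ) :
    Φ.angularIntegral =O[atTop] (· ^ (-a)) := by
  obtain ⟨C, hC0, hC⟩ := Φ.exists_norm_polarCoord_symm_le ⌈a⌉₊
  refine IsBigO.of_bound (C * |Real.pi - -Real.pi|) ?_
  filter_upwards [eventually_ge_atTop 1] with r hr
  have hr0 : 0 < r := by linarith
  have h := intervalIntegral.norm_integral_le_of_norm_le_const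
    (a := -Real.pi) (b := Real.pi) fun θ _ => hC r θ hr0
  refine h.trans ?_
  rw [mul_right_comm]
  refine mul_le_mul_of_nonneg_left ?_ (by positivity)
  rw [Real.rpow_neg hr0.le, norm_inv, Real.norm_of_nonneg (by positivity)]
  refine inv_anti₀ (by positivity) ?_
  calc r ^ a ≤ r ^ (⌈a⌉₊ : ℝ) := Real.rpow_le_rpow_of_exponent_le hr (Nat.le_ceil a)
    _ = r ^ ⌈a⌉₊ := Real.rpow_natCast _ _
    _ ≤ (1 + r) ^ ⌈a⌉₊ := pow_le_pow_left₀ hr0.le (by linarith) _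

theorem integrableOn_cpow_mul_polarCoord (Φ : SchwartzMap (ℝ × ℝ) ℂ) {s : ℂ} (hs : 0 < s.re) :
    IntegrableOn (fun p : ℝ × ℝ =>
      (p.1 : ℂ) ^ (s - 1) * Φ (p.1 * Real.cos p.2, p.1 * Real.sin p.2))
      (Set.Ioi 0 ×ˢ Set.Ioo (-Real.pi) Real.pi) := by
  set n : ℕ := ⌈s.re⌉₊ + 1
  obtain ⟨C, hC0, hC⟩ := Φ.exists_norm_polarCoord_symm_le n
  have hrad : IntegrableOn (fun r : ℝ => r ^ (s.re - 1) * ((1 + r) ^ n)⁻¹) (Set.Ioi 0) := by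
    have hcont : ContinuousOn (fun r : ℝ => ((1 + r) ^ n)⁻¹) (Set.Ici 0) :=
      ContinuousOn.inv₀ (by fun_prop) fun r hr => by
        have : 0 < 1 + r := by linarith [Set.mem_Ici.1 hr]
        positivity
    refine mellin_convergent_of_isBigO_scalar (a := n) (b := 0)
      ((hcont.mono Set.Ioi_subset_Ici_self).locallyIntegrableOn measurableSet_Ioi) ?_ ?_ ?_ hs
    · refine IsBigO.of_bound 1 ?_
      filter_upwards [eventually_gt_atTop 0] with r hr
      rw [Real.rpow_neg hr.le, Real.rpow_natCast, one_mul, norm_inv, norm_inv,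
        Real.norm_of_nonneg (by positivity), Real.norm_of_nonneg (by positivity)]
      exact inv_anti₀ (by positivity) (pow_le_pow_left₀ hr.le (by linarith) _)
    · have := (Nat.le_ceil s.re)
      simp only [n]
      push_cast
      linarith
    · refine IsBigO.of_bound 1 ?_
      filter_upwards [self_mem_nhdsWithin] with r hr
      have hr : 0 < r := hr
      rw [neg_zero, Real.rpow_zero, norm_inv, Real.norm_of_nonneg (by positivity), norm_one, one_mul]
      exact inv_le_one_of_one_le₀ (one_le_pow₀ (by linarith))
  rw [IntegrableOn, Measure.volume_eq_prod, ← Measure.prod_restrict]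
  have hdom := Integrable.mul_prod hrad
    (integrable_const (μ := volume.restrict (Set.Ioo (-Real.pi) Real.pi)) C)
  refine hdom.mono' ?_ ?_
  · have := Φ.continuous.measurable
    refine Measurable.aestronglyMeasurable ?_
    fun_prop
  · rw [Measure.prod_restrict]
    filter_upwards [ae_restrict_mem (measurableSet_Ioi.prod measurableSet_Ioo)] with p hp
    have hp : 0 < p.1 := hp.1
    rw [norm_mul, Complex.norm_cpow_eq_rpow_re_of_pos hp, mul_assoc, mul_comm _ C]
    exact mul_le_mul_of_nonneg_left (hC _ _ hp) (by positivity)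

theorem polarCoord_smul_mul_cpow (Φ : SchwartzMap (ℝ × ℝ) ℂ) (s : ℂ) {p : ℝ × ℝ}
    (hp : p ∈ polarCoord.target) :
    p.1 • (Φ (polarCoord.symm p) *
        (((polarCoord.symm p).1 ^ 2 + (polarCoord.symm p).2 ^ 2 : ℝ) : ℂ) ^ (s - 1)) =
      (p.1 : ℂ) ^ (2 * s - 1) * Φ (p.1 * Real.cos p.2, p.1 * Real.sin p.2) := by
  have h : (p.1 * Real.cos p.2) ^ 2 + (p.1 * Real.sin p.2) ^ 2 = p.1 ^ 2 := by
    rw [mul_pow, mul_pow, ← mul_add, Real.cos_sq_add_sin_sq, mul_one]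
  rw [polarCoord_symm_apply, h, ← Complex.mul_ofReal_sq_cpow_sub_one hp.1, Complex.real_smul]
  ring

theorem integrable_mul_cpow (Φ : SchwartzMap (ℝ × ℝ) ℂ) {s : ℂ} (hs : 0 < s.re) :
    Integrable (fun q : ℝ × ℝ => Φ q * ((q.1 ^ 2 + q.2 ^ 2 : ℝ) : ℂ) ^ (s - 1)) :=
  integrable_of_integrableOn_polarCoord <|
    (Φ.integrableOn_cpow_mul_polarCoord (s := 2 * s) (by simpa using hs)).congr_fun
      (fun _ hp => (Φ.polarCoord_smul_mul_cpow s hp).symm) polarCoord.open_target.measurableSet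

theorem integral_mul_cpow_eq_mellin (Φ : SchwartzMap (ℝ × ℝ) ℂ) {s : ℂ} (hs : 0 < s.re) :
    ∫ q : ℝ × ℝ, Φ q * ((q.1 ^ 2 + q.2 ^ 2 : ℝ) : ℂ) ^ (s - 1) =
      mellin Φ.angularIntegral (2 * s) := by
  rw [← integral_comp_polarCoord_symm,
    setIntegral_congr_fun polarCoord.open_target.measurableSet
      fun _ hp => Φ.polarCoord_smul_mul_cpow s hp, polarCoord_target, Measure.volume_eq_prod,
    setIntegral_prod _ (Φ.integrableOn_cpow_mul_polarCoord (s := 2 * s) (by simpa using hs)),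
    mellin]
  refine setIntegral_congr_fun measurableSet_Ioi fun r _ => ?_
  simp only [angularIntegral, smul_eq_mul]
  rw [intervalIntegral.integral_of_le (by linarith [Real.pi_pos]), integral_Ioc_eq_integral_Ioo,
    integral_const_mul]

/-- The `k`-th Taylor coefficient at `0` of `Φ.angularIntegral`. -/
noncomputable def angularCoeff (Φ : SchwartzMap (ℝ × ℝ) ℂ) (k : ℕ) : ℂ :=
  ∫ θ in -Real.pi..Real.pi,
    (k ! : ℝ)⁻¹ • iteratedFDeriv ℝ k Φ 0 (fun _ => (Real.cos θ, Real.sin θ))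

theorem angularCoeff_zero (Φ : SchwartzMap (ℝ × ℝ) ℂ) :
    Φ.angularCoeff 0 = 2 * (Real.pi * Φ (0, 0)) := by
  simp only [angularCoeff, Nat.factorial_zero, Nat.cast_one, inv_one, one_smul,
    iteratedFDeriv_zero_apply, intervalIntegral.integral_const, Complex.real_smul]
  push_cast
  rw [← Prod.zero_eq_mk]
  ring

theorem angularCoeff_eq_zero_of_odd (Φ : SchwartzMap (ℝ × ℝ) ℂ) {k : ℕ} (hk : Odd k) :
    Φ.angularCoeff k = 0 := by
  set p : ℝ → ℂ := fun θ =>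
    (k ! : ℝ)⁻¹ • iteratedFDeriv ℝ k Φ 0 (fun _ => (Real.cos θ, Real.sin θ)) with hp
  have hanti : Function.Antiperiodic p Real.pi := fun θ => by
    have h := (iteratedFDeriv ℝ k Φ 0).map_smul_univ (fun _ => (-1 : ℝ))
      (fun _ => (Real.cos θ, Real.sin θ))
    simp only [Finset.prod_const, Finset.card_univ, Fintype.card_fin, hk.neg_one_pow, neg_smul,
      one_smul, Prod.neg_mk] at h
    simp only [hp, Real.cos_add_pi, Real.sin_add_pi, h, smul_neg]
  have h1 := hanti.periodic_two_mul.intervalIntegral_add_eq (-Real.pi) 0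
  have h2 := intervalIntegral.integral_comp_add_right (a := -Real.pi) (b := Real.pi) p Real.pi
  simp only [hanti _, intervalIntegral.integral_neg] at h2
  ring_nf at h1 h2
  rw [← h1] at h2
  change ∫ θ in -Real.pi..Real.pi, p θ = 0
  exact self_eq_neg.1 h2.symm

theorem norm_angularIntegral_sub_le (Φ : SchwartzMap (ℝ × ℝ) ℂ) (n : ℕ) {r : ℝ}
    (hr : r ∈ Set.Icc (0 : ℝ) 1) :
    ‖Φ.angularIntegral r - ∑ k ∈ Finset.range (n + 1), Φ.angularCoeff k * (r : ℂ) ^ k‖ ≤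
      SchwartzMap.seminorm ℝ 0 (n + 1) Φ * r ^ (n + 1) / n ! * |Real.pi - -Real.pi| := by
  have hcont (k : ℕ) : Continuous fun θ : ℝ => r ^ k •
      ((k ! : ℝ)⁻¹ • iteratedFDeriv ℝ k Φ 0 (fun _ => (Real.cos θ, Real.sin θ))) :=
    Continuous.const_smul (Continuous.const_smul ((iteratedFDeriv ℝ k Φ 0).coe_continuous.comp
      (f := fun (θ : ℝ) (_ : Fin k) => (Real.cos θ, Real.sin θ)) (by fun_prop)) (k ! : ℝ)⁻¹) (r ^ k)
  have hΦ : Continuous fun θ : ℝ => Φ (r * Real.cos θ, r * Real.sin θ) :=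
    Φ.continuous.comp (by fun_prop)
  have e : Φ.angularIntegral r - ∑ k ∈ Finset.range (n + 1), Φ.angularCoeff k * (r : ℂ) ^ k =
      ∫ θ in -Real.pi..Real.pi, (Φ (r • (Real.cos θ, Real.sin θ)) -
        ∑ k ∈ Finset.range (n + 1), r ^ k •
          ((k ! : ℝ)⁻¹ • iteratedFDeriv ℝ k Φ 0 (fun _ => (Real.cos θ, Real.sin θ)))) := by
    simp only [Prod.smul_mk, smul_eq_mul]
    rw [intervalIntegral.integral_sub (hΦ.intervalIntegrable _ _)
        ((continuous_finsetSum _ fun k _ => hcont k).intervalIntegrable _ _),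
      intervalIntegral.integral_finsetSum
        fun k _ => (hcont k).intervalIntegrable _ _]
    congr 1
    refine Finset.sum_congr rfl fun k _ => ?_
    rw [intervalIntegral.integral_smul, angularCoeff, Complex.real_smul, mul_comm]
    push_cast
    rfl
  rw [e]
  refine intervalIntegral.norm_integral_le_of_norm_le_const fun θ _ => ?_
  refine Φ.norm_sub_taylor_smul_le n ?_ hr
  exact max_le (Real.abs_cos_le_one θ) (Real.abs_sin_le_one θ)

theorem angularIntegral_sub_isBigO (Φ : SchwartzMap (ℝ × ℝ) ℂ) (N : ℕ) :
    (fun r : ℝ => Φ.angularIntegral r -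
        ∑ k ∈ Finset.range N, Φ.angularCoeff (2 * k) * (r : ℂ) ^ (2 * k))
      =O[𝓝[>] 0] fun r => r ^ (2 * N) := by
  have hsum (r : ℝ) : ∑ k ∈ Finset.range N, Φ.angularCoeff (2 * k) * (r : ℂ) ^ (2 * k) =
      ∑ k ∈ Finset.range (2 * N), Φ.angularCoeff k * (r : ℂ) ^ k := by
    induction N with
    | zero => simp
    | succ N ih =>
      rw [Finset.sum_range_succ, ih, mul_add, mul_one, Finset.sum_range_succ,
        Finset.sum_range_succ, Φ.angularCoeff_eq_zero_of_odd (odd_two_mul_add_one N), zero_mul,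
        add_zero]
  simp only [hsum]
  rcases h : 2 * N with _ | n
  · simpa using (Φ.continuous_angularIntegral.tendsto 0).mono_left nhdsWithin_le_nhds
      |>.isBigO_one ℝ
  · refine IsBigO.of_bound (SchwartzMap.seminorm ℝ 0 (n + 1) Φ / n ! * |Real.pi - -Real.pi|) ?_
    filter_upwards [Ioc_mem_nhdsGT zero_lt_one] with r hr
    refine (Φ.norm_angularIntegral_sub_le n (Set.Ioc_subset_Icc_self hr)).trans_eq ?_
    rw [Real.norm_of_nonneg (pow_nonneg hr.1.le _)]
    ring

end SchwartzMap

/-- The Mellin transform in the norm invariant `ξ = x² + y²` of the `SO(2)`-orbital integrals of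
a Schwartz function on `ℝ²`: `Z(s) = ∫ Φ(x,y)(x²+y²)^{s-1} dx dy` converges for `Re s > 0` and
equals `Γ(s)·G(s)` with `G` entire and `G(0) = π·Φ(0,0)`; in particular `δ·Z(δ) → π·Φ(0,0)` as
`δ → 0⁺`. -/
theorem stmt_10 (Φ : SchwartzMap (ℝ × ℝ) ℂ) :
    (∀ s : ℂ, 0 < s.re →
      Integrable (fun q : ℝ × ℝ => Φ q * ((q.1 ^ 2 + q.2 ^ 2 : ℝ) : ℂ) ^ (s - 1))) ∧
    ∃ G : ℂ → ℂ, Differentiable ℂ G ∧ G 0 = Real.pi * Φ (0, 0) ∧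
      (∀ s : ℂ, 0 < s.re →
        (∫ q : ℝ × ℝ, Φ q * ((q.1 ^ 2 + q.2 ^ 2 : ℝ) : ℂ) ^ (s - 1)) =
          Complex.Gamma s * G s) ∧
      Filter.Tendsto
        (fun δ : ℝ => (δ : ℂ) *
          ∫ q : ℝ × ℝ, Φ q * ((q.1 ^ 2 + q.2 ^ 2 : ℝ) : ℂ) ^ ((δ : ℂ) - 1))
        (nhdsWithin 0 (Set.Ioi 0)) (nhds (Real.pi * Φ (0, 0))) := by
  refine ⟨fun s hs => Φ.integrable_mul_cpow hs, ?_⟩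
  obtain ⟨G, hG, hG0, hGs⟩ := exists_entire_mellin_eq_Gamma_mul
    (b := fun k => Φ.angularCoeff (2 * k))
    (Φ.continuous_angularIntegral.locallyIntegrable.locallyIntegrableOn _)
    Φ.angularIntegral_isBigO_atTop Φ.angularIntegral_sub_isBigO
  have hG0 : G 0 = Real.pi * Φ (0, 0) := by
    rw [hG0, mul_zero, Φ.angularCoeff_zero, mul_div_cancel_left₀ _ two_ne_zero]
  refine ⟨G, hG, hG0, fun s hs => by rw [Φ.integral_mul_cpow_eq_mellin hs, hGs s hs], ?_⟩
  have hcont : ContinuousAt (fun δ : ℝ => Complex.Gamma ((δ : ℂ) + 1) * G δ) 0 := by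
    refine ContinuousAt.mul ?_ (hG.continuous.comp Complex.continuous_ofReal).continuousAt
    refine ContinuousAt.comp (g := Complex.Gamma) ?_
      (Complex.continuous_ofReal.add continuous_const).continuousAt
    simpa using Complex.differentiableAt_Gamma_one.continuousAt
  have hlim := hcont.tendsto.mono_left (nhdsWithin_le_nhds (s := Set.Ioi 0))
  simp only [Complex.ofReal_zero, zero_add, Complex.Gamma_one, one_mul, hG0] at hlim
  refine hlim.congr' ?_
  filter_upwards [self_mem_nhdsWithin] with δ hδ
  have hδ : 0 < δ := hδ
  rw [Φ.integral_mul_cpow_eq_mellin (by simpa using hδ), hGs _ (by simpa using hδ),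
    Complex.Gamma_add_one _ (mod_cast hδ.ne'), mul_assoc]
end
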